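/- arXiv:2204.13034 — 6 statements merged into one kernel-verified Lean document; each statement's English description precedes it below -/
import Mathlib

section
/- The distributionally robust KL minimization over Wasserstein balls centered at empirical measures reduces to a finite-dimensional program: the infimum of KL(ν‖μ) over all probability measures μ with W(μ,μ0) ≤ r1 and ν with W(ν,ν0) ≤ r2 equals the minimum of Σ_{l=1}^n p2^l·log(p2^l/p1^l) over vectors p1, p2 ∈ ℝ_+^n and matrices Γ1, Γ2 ∈ ℝ_+^{n×n} subject to: Σ_{l,m} Γ1[l,m]·c(z_l,z_m) ≤ r1 and Σ_{l,m} Γ2[l,m]·c(z_l,z_m) ≤ r2; the row-sum vector of Γ1 equals (1/n1,…,1/n1,0,…,0) (the weight vector of μ0 on (z_1,…,z_n)) and the row-sum vector of Γ2 equals (0,…,0,1/n2,…,1/n2) (the weight vector of ν0); the column-sum vector of Γ1 equals p1 and the column-sum vector of Γ2 equals p2 (so p1, p2 are automatically probability vectors). Both sides are valued in (−∞,+∞] with the conventions 0·log(0/a)=0 for a ≥ 0 and b·log(b/0)=+∞ for b > 0, and the finite-dimensional minimum is attained. -/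
open MeasureTheory Real ENNReal

noncomputable section

open Classical in

/-- Kullback–Leibler divergence `KL(ν‖μ) = ∫ log (dν/dμ) dν`, valued in `(-∞, +∞]` (as `EReal`):
it is the Bochner integral of the log-likelihood ratio when `ν ≪ μ` and this ratio is
`ν`-integrable, and `+∞` otherwise (for probability measures with `ν ≪ μ` the negative part of
`log (dν/dμ)` is always `ν`-integrable, so non-integrability means the integral is `+∞`). -/
def KLdiv {X : Type*} [MeasurableSpace X] (ν μ : Measure X) : EReal :=
  if ν ≪ μ ∧ Integrable (llr ν μ) ν then ((∫ a, llr ν μ a ∂ν : ℝ) : EReal) else ⊤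

/-- Order-1 Wasserstein distance with transport cost `c`: the infimum of `∫ c dΓ` over all
couplings `Γ` of `P` and `Q` (measures on `X × X` with first marginal `P` and second
marginal `Q`). -/
def wassDist {X : Type*} [MeasurableSpace X] (c : X → X → ℝ) (P Q : Measure X) : ℝ≥0∞ :=
  ⨅ (Γ : Measure (X × X)) (_ : Γ.map Prod.fst = P) (_ : Γ.map Prod.snd = Q),
    ∫⁻ p, ENNReal.ofReal (c p.1 p.2) ∂Γ

/-- Empirical measure `(1/n) ∑ᵢ δ_{x i}` of `n` points. -/
def empMeasure {X : Type*} [MeasurableSpace X] {n : ℕ} (x : Fin n → X) : Measure X :=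
  ((n : ℝ≥0∞)⁻¹) • ∑ i, Measure.dirac (x i)

/-- The set of values `KL(ν‖μ)` as `(μ, ν)` ranges over the pairs of probability measures in the
Wasserstein balls of radii `r1, r2` around the empirical measures of `x` and `y`. -/
def klBallValues {X : Type*} [MeasurableSpace X] [MetricSpace X] {n1 n2 : ℕ}
    (x : Fin n1 → X) (y : Fin n2 → X) (r1 r2 : ℝ) : Set EReal :=
  {e | ∃ μ ν : Measure X, IsProbabilityMeasure μ ∧ IsProbabilityMeasure ν ∧
    wassDist dist μ (empMeasure x) ≤ ENNReal.ofReal r1 ∧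
    wassDist dist ν (empMeasure y) ≤ ENNReal.ofReal r2 ∧ e = KLdiv ν μ}

/-- Feasibility for the finite-dimensional program: `p1, p2 ∈ ℝ₊ⁿ`, `Γ1, Γ2 ∈ ℝ₊^{n×n}`,
transport-cost constraints with radii `r1, r2`, row sums of `Γ1` (resp. `Γ2`) equal to the weight
vector `(1/n1,…,1/n1,0,…,0)` of `μ0` (resp. `(0,…,0,1/n2,…,1/n2)` of `ν0`) on
`z = (x_1,…,x_{n1},y_1,…,y_{n2})`, and column sums equal to `p1` (resp. `p2`). -/
def progFeasible {X : Type*} [MeasurableSpace X] [MetricSpace X] {n1 n2 : ℕ}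
    (x : Fin n1 → X) (y : Fin n2 → X) (r1 r2 : ℝ)
    (p1 p2 : Fin (n1 + n2) → ℝ) (Γ1 Γ2 : Fin (n1 + n2) → Fin (n1 + n2) → ℝ) : Prop :=
  (∀ l, 0 ≤ p1 l) ∧ (∀ l, 0 ≤ p2 l) ∧ (∀ l m, 0 ≤ Γ1 l m) ∧ (∀ l m, 0 ≤ Γ2 l m) ∧
  (∑ l, ∑ m, Γ1 l m * dist (Fin.append x y l) (Fin.append x y m)) ≤ r1 ∧
  (∑ l, ∑ m, Γ2 l m * dist (Fin.append x y l) (Fin.append x y m)) ≤ r2 ∧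
  (∀ l, (∑ m, Γ1 l m) = if (l : ℕ) < n1 then (n1 : ℝ)⁻¹ else 0) ∧
  (∀ l, (∑ m, Γ2 l m) = if (l : ℕ) < n1 then 0 else (n2 : ℝ)⁻¹) ∧
  (∀ m, (∑ l, Γ1 l m) = p1 m) ∧ (∀ m, (∑ l, Γ2 l m) = p2 m)

/-- Objective `∑ₗ p2ˡ log (p2ˡ / p1ˡ)` of the finite-dimensional program, valued in
`(-∞, +∞]`, with the conventions `0 · log (0/a) = 0` for `a ≥ 0` and
`b · log (b/0) = +∞` for `b > 0`. -/
def progObj {n : ℕ} (p1 p2 : Fin n → ℝ) : EReal :=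
  ∑ l, (if p2 l = 0 then (0 : EReal) else if p1 l = 0 then (⊤ : EReal)
        else (((p2 l) * Real.log (p2 l / p1 l) : ℝ) : EReal))

/-- The set of objective values of the finite-dimensional program over its feasible points. -/
def progValues {X : Type*} [MeasurableSpace X] [MetricSpace X] {n1 n2 : ℕ}
    (x : Fin n1 → X) (y : Fin n2 → X) (r1 r2 : ℝ) : Set EReal :=
  {e | ∃ (p1 p2 : Fin (n1 + n2) → ℝ) (Γ1 Γ2 : Fin (n1 + n2) → Fin (n1 + n2) → ℝ),
    progFeasible x y r1 r2 p1 p2 Γ1 Γ2 ∧ e = progObj p1 p2}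

open Filter Topology ProbabilityTheory Set

/-- The convex function `(a, b) ↦ b log (b / a)` on the quadrant, as a supremum of linear
functions. -/
def klTerm (a b : ℝ) : EReal :=
  ⨆ t : ℝ, ((b * (1 + t) - a * exp t : ℝ) : EReal)

theorem klTerm_ne_bot (a b : ℝ) : klTerm a b ≠ ⊥ := by
  have h := le_iSup (fun t : ℝ => ((b * (1 + t) - a * exp t : ℝ) : EReal)) 0
  intro h'
  rw [klTerm] at h'
  rw [h'] at h
  exact EReal.coe_ne_bot _ (le_bot_iff.1 h)

theorem mul_one_add_sub_le_exp {h : ℝ} (hh : 0 ≤ h) (t : ℝ) :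
    h * (1 + t - log h) ≤ exp t := by
  rcases hh.eq_or_lt with rfl | hpos
  · simpa using (exp_pos t).le
  · have h1 := add_one_le_exp (t - log h)
    rw [exp_sub, exp_log hpos, le_div_iff₀ hpos] at h1
    linarith

theorem klTerm_zero_right {a : ℝ} (ha : 0 ≤ a) : klTerm a 0 = 0 := by
  apply le_antisymm
  · refine iSup_le fun t => ?_
    have := mul_nonneg ha (exp_pos t).le
    exact_mod_cast (by linarith : 0 * (1 + t) - a * exp t ≤ 0)
  · have ht : Tendsto (fun t : ℝ => ((0 * (1 + t) - a * exp t : ℝ) : EReal)) atBot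
        (𝓝 ((0 : ℝ) : EReal)) := by
      refine (continuous_coe_real_ereal.tendsto _).comp ?_
      simpa using (tendsto_exp_atBot.const_mul a).neg
    exact le_of_tendsto' ht fun t => le_iSup
      (fun t : ℝ => ((0 * (1 + t) - a * exp t : ℝ) : EReal)) t

theorem klTerm_zero_left {b : ℝ} (hb : 0 < b) : klTerm 0 b = ⊤ := by
  rw [EReal.eq_top_iff_forall_lt]
  intro y
  refine lt_of_lt_of_le ?_ (le_iSup _ (y / b))
  rw [EReal.coe_lt_coe_iff, mul_add, mul_div_cancel₀ _ hb.ne']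
  linarith

theorem klTerm_of_pos {a b : ℝ} (ha : 0 < a) (hb : 0 < b) :
    klTerm a b = ((b * log (b / a) : ℝ) : EReal) := by
  apply le_antisymm
  · refine iSup_le fun t => ?_
    rw [EReal.coe_le_coe_iff]
    have h1 := mul_le_mul_of_nonneg_left (mul_one_add_sub_le_exp (div_pos hb ha).le t) ha.le
    have h2 : a * (b / a * (1 + t - log (b / a))) = b * (1 + t - log (b / a)) := by
      field_simp
    rw [h2] at h1
    linarith
  · refine le_trans (le_of_eq ?_) (le_iSup _ (log (b / a)))
    rw [exp_log (div_pos hb ha), mul_div_cancel₀ _ ha.ne']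
    congr 1
    ring

theorem progObj_eq_sum_klTerm {n : ℕ} {p1 p2 : Fin n → ℝ} (h1 : ∀ l, 0 ≤ p1 l)
    (h2 : ∀ l, 0 ≤ p2 l) : progObj p1 p2 = ∑ l, klTerm (p1 l) (p2 l) := by
  refine Finset.sum_congr rfl fun l _ => ?_
  rcases (h2 l).eq_or_lt with h | h
  · simp [← h, klTerm_zero_right (h1 l)]
  · rw [if_neg h.ne']
    rcases (h1 l).eq_or_lt with h' | h'
    · simp [← h', klTerm_zero_left h]
    · rw [if_neg h'.ne', klTerm_of_pos h' h]

theorem sum_klTerm_ne_bot {ι : Type*} (s : Finset ι) (a b : ι → ℝ) :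
    ∑ i ∈ s, klTerm (a i) (b i) ≠ ⊥ := by
  classical
  induction s using Finset.induction_on with
  | empty => simp
  | insert i s hi ih =>
    simpa [Finset.sum_insert hi, EReal.add_eq_bot_iff] using ⟨klTerm_ne_bot _ _, ih⟩

theorem lowerSemicontinuous_sum_klTerm {T ι : Type*} [TopologicalSpace T] (s : Finset ι)
    {a b : ι → T → ℝ} (ha : ∀ i, Continuous (a i)) (hb : ∀ i, Continuous (b i)) :
    LowerSemicontinuous fun x => ∑ i ∈ s, klTerm (a i x) (b i x) := by
  classical
  induction s using Finset.induction_on with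
  | empty => simpa using lowerSemicontinuous_const
  | insert i s hi ih =>
    simp only [Finset.sum_insert hi]
    refine LowerSemicontinuous.add' ?_ ih fun x => ?_
    · refine lowerSemicontinuous_iSup fun t => Continuous.lowerSemicontinuous ?_
      exact continuous_coe_real_ereal.comp
        (((hb i).mul continuous_const).sub ((ha i).mul continuous_const))
    · exact EReal.continuousAt_add (Or.inr (sum_klTerm_ne_bot _ _ _)) (Or.inl (klTerm_ne_bot _ _))

theorem progObj_eq_top {n : ℕ} {p1 p2 : Fin n → ℝ} (h1 : ∀ l, 0 ≤ p1 l) (h2 : ∀ l, 0 ≤ p2 l)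
    {l : Fin n} (hl1 : p1 l = 0) (hl2 : p2 l ≠ 0) : progObj p1 p2 = ⊤ := by
  rw [progObj_eq_sum_klTerm h1 h2, ← Finset.add_sum_erase _ _ (Finset.mem_univ l), hl1,
    klTerm_zero_left ((h2 l).lt_of_ne' hl2)]
  exact EReal.top_add_of_ne_bot (sum_klTerm_ne_bot _ _ _)

theorem coe_sum_ereal {ι : Type*} (s : Finset ι) (f : ι → ℝ) :
    ((∑ i ∈ s, f i : ℝ) : EReal) = ∑ i ∈ s, (f i : EReal) :=
  map_sum (⟨⟨Real.toEReal, EReal.coe_zero⟩, EReal.coe_add⟩ : ℝ →+ EReal) f s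

/-- Data processing inequality for a finite-valued kernel `k`. -/
theorem sum_klTerm_integral_le {X ι : Type*} [MeasurableSpace X] [Fintype ι] {μ ν : Measure X}
    [IsProbabilityMeasure μ] [IsProbabilityMeasure ν] (hac : ν ≪ μ)
    (hllr : Integrable (llr ν μ) ν) {k : ι → X → ℝ} (hkm : ∀ l, Measurable (k l))
    (hk0 : ∀ l w, 0 ≤ k l w) (hk1 : ∀ w, ∑ l, k l w = 1) :
    ∑ l, klTerm (∫ w, k l w ∂μ) (∫ w, k l w ∂ν) ≤ ((∫ w, llr ν μ w ∂ν : ℝ) : EReal) := by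
  have hkle : ∀ l w, k l w ≤ 1 := fun l w => by
    rw [← hk1 w]
    exact Finset.single_le_sum (f := fun l => k l w) (fun l _ => hk0 l w) (Finset.mem_univ l)
  have hkint : ∀ (P : Measure X) [IsProbabilityMeasure P] l, Integrable (k l) P :=
    fun P _ l => Integrable.of_mem_Icc 0 1 (hkm l).aemeasurable
      (ae_of_all _ fun w => ⟨hk0 l w, hkle l w⟩)
  have hkllr : ∀ l, Integrable (fun w => k l w * llr ν μ w) ν := fun l =>
    hllr.bdd_mul (c := 1) (hkm l).aestronglyMeasurable (ae_of_all _ fun w => by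
      rw [Real.norm_of_nonneg (hk0 l w)]; exact hkle l w)
  have hsum : ∫ w, llr ν μ w ∂ν = ∑ l, ∫ w, k l w * llr ν μ w ∂ν := by
    rw [← integral_finsetSum _ fun l _ => hkllr l]
    refine integral_congr_ae (ae_of_all _ fun w => ?_)
    simp only [← Finset.sum_mul, hk1, one_mul]
  rw [hsum, coe_sum_ereal]
  refine Finset.sum_le_sum fun l _ => iSup_le fun t => ?_
  rw [EReal.coe_le_coe_iff]
  have hi : Integrable (fun w => k l w * (1 + t) - k l w * llr ν μ w) ν :=
    ((hkint ν l).mul_const _).sub (hkllr l)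
  have h1 : ∫ w, (k l w * (1 + t) - k l w * llr ν μ w) ∂ν ≤ ∫ w, k l w * exp t ∂μ := by
    rw [← integral_rnDeriv_smul hac]
    refine integral_mono ((integrable_rnDeriv_smul_iff hac).2 hi)
      ((hkint μ l).mul_const _) fun w => ?_
    have h2 := mul_le_mul_of_nonneg_left
      (mul_one_add_sub_le_exp (h := (ν.rnDeriv μ w).toReal) toReal_nonneg t) (hk0 l w)
    simp only [llr, smul_eq_mul]
    linarith
  rw [integral_sub ((hkint ν l).mul_const _) (hkllr l), integral_mul_const,
    integral_mul_const] at h1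
  linarith

/-- A measure whose second marginal is an empirical measure is carried by finitely many second
coordinates; its conditional weights on the atoms form a measurable partition of unity. -/
theorem exists_weights_of_coupling {X : Type*} [MeasurableSpace X] [MetricSpace X] [PolishSpace X]
    [BorelSpace X] {n : ℕ} (hn : 0 < n) (x : Fin n → X) {P : Measure X} [IsProbabilityMeasure P]
    {Γ : Measure (X × X)} (h1 : Γ.map Prod.fst = P) (h2 : Γ.map Prod.snd = empMeasure x) :
    ∃ f : Fin n → X → ℝ, (∀ i, Measurable (f i)) ∧ (∀ i w, 0 ≤ f i w) ∧ (∀ w, ∑ i, f i w = 1) ∧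
      (∀ i, ∫ w, f i w ∂P = (n : ℝ)⁻¹) ∧
      ∫⁻ w, ENNReal.ofReal (∑ i, f i w * dist w (x i)) ∂P ≤
        ∫⁻ p, ENNReal.ofReal (dist p.1 p.2) ∂Γ := by
  classical
  have : Nonempty X := ⟨x ⟨0, hn⟩⟩
  have hΓ : IsProbabilityMeasure Γ := by
    constructor
    rw [← Set.preimage_univ (f := Prod.fst), ← Measure.map_apply measurable_fst .univ, h1]
    exact measure_univ
  have hdis : P ⊗ₘ Γ.condKernel = Γ := by
    conv_rhs => rw [← Γ.disintegrate Γ.condKernel, Measure.fst, h1]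
  set κ := Γ.condKernel
  have hn0 : (n : ℝ) ≠ 0 := by positivity
  let c : X → ℕ := fun z => (Finset.univ.filter fun i => x i = z).card
  have hc : ∀ i, (c (x i) : ℝ) ≠ 0 := fun i => by
    have : 0 < c (x i) := Finset.card_pos.2 ⟨i, by simp⟩
    positivity
  have hcz : ∀ z ∈ Finset.univ.image x, (c z : ℝ) ≠ 0 := by
    intro z hz
    obtain ⟨i, -, rfl⟩ := Finset.mem_image.1 hz
    exact hc i
  let S : Set X := (Finset.univ.image x : Finset X)
  have hS : MeasurableSet S := Finset.measurableSet _
  have hemp : ∀ i, empMeasure x {x i} = (n : ℝ≥0∞)⁻¹ * c (x i) := fun i => by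
    simp [empMeasure, c, Finset.sum_boole, Set.indicator_apply]
  have hκS : ∀ᵐ w ∂P, ∀ᵐ z ∂κ w, z ∈ S := by
    have h3 : ∀ᵐ z ∂Γ.map Prod.snd, z ∈ S := by
      rw [h2, empMeasure, ae_iff, Measure.smul_apply, Measure.finsetSum_apply]
      simp [S]
    have h4 := ae_of_ae_map measurable_snd.aemeasurable h3
    rw [← hdis, Measure.ae_compProd_iff (measurable_snd hS)] at h4
    exact h4
  let g : Fin n → X → ℝ := fun i w => (κ w).real {x i} / c (x i)
  have hgm : ∀ i, Measurable (g i) := fun i =>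
    ((κ.measurable_coe (measurableSet_singleton _)).ennreal_toReal).div_const _
  have hg0 : ∀ i w, 0 ≤ g i w := fun i w => by positivity
  have hgsum : ∀ (F : X → ℝ) w, ∑ i, g i w * F (x i) =
      ∑ z ∈ Finset.univ.image x, (κ w).real {z} * F z := by
    intro F w
    rw [Finset.sum_comp (fun z => (κ w).real {z} / c z * F z) x]
    refine Finset.sum_congr rfl fun z hz => ?_
    have := hcz z hz
    rw [nsmul_eq_mul]
    change (c z : ℝ) * _ = _
    field_simp
  have hg1 : ∀ᵐ w ∂P, ∑ i, g i w = 1 := by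
    filter_upwards [hκS] with w hw
    have h3 := hgsum (fun _ => 1) w
    simp only [mul_one] at h3
    rw [h3, sum_measureReal_singleton]
    have h4 : (κ w) S = 1 := prob_compl_eq_zero_iff hS |>.1 hw
    simp [Measure.real, S] at h4 ⊢
    simp [h4]
  have hgint : ∀ i, ∫ w, g i w ∂P = (n : ℝ)⁻¹ := by
    intro i
    have h3 : Γ (Prod.snd ⁻¹' {x i}) = (n : ℝ≥0∞)⁻¹ * c (x i) := by
      rw [← Measure.map_apply measurable_snd (measurableSet_singleton _), h2, hemp]
    rw [← hdis, Measure.compProd_apply (measurable_snd (measurableSet_singleton _))] at h3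
    have h4 : ∫ w, (κ w).real {x i} ∂P = (n : ℝ)⁻¹ * c (x i) := by
      simp only [Measure.real]
      rw [integral_toReal (κ.measurable_coe (measurableSet_singleton _)).aemeasurable
        (ae_of_all _ fun w => measure_lt_top _ _)]
      change ∫⁻ w, (κ w) {x i} ∂P = _ at h3
      rw [h3]
      simp
    simp only [g, integral_div, h4]
    exact mul_div_cancel_right₀ _ (hc i)
  have hgcost : ∫⁻ w, ENNReal.ofReal (∑ i, g i w * dist w (x i)) ∂P ≤
        ∫⁻ p, ENNReal.ofReal (dist p.1 p.2) ∂Γ := by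
    conv_rhs => rw [← hdis]
    rw [Measure.lintegral_compProd (f := fun p : X × X => ENNReal.ofReal (dist p.1 p.2))
      (measurable_fst.dist measurable_snd).ennreal_ofReal]
    refine lintegral_mono fun w => ?_
    refine le_trans (le_of_eq ?_) (setLIntegral_le_lintegral S _)
    rw [hgsum, lintegral_finset, ENNReal.ofReal_sum_of_nonneg fun z _ => by positivity]
    refine Finset.sum_congr rfl fun z _ => ?_
    rw [ENNReal.ofReal_mul measureReal_nonneg, mul_comm, ofReal_measureReal]
  let f : Fin n → X → ℝ := fun i w => if ∑ j, g j w = 1 then g i w else (n : ℝ)⁻¹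
  have hfg : ∀ᵐ w ∂P, ∀ i, f i w = g i w := by
    filter_upwards [hg1] with w hw i
    simp [f, hw]
  refine ⟨f, fun i => ?_, fun i w => ?_, fun w => ?_, fun i => ?_, ?_⟩
  · exact Measurable.ite ((Finset.measurable_sum _ fun j _ => hgm j) (measurableSet_singleton 1))
      (hgm i) measurable_const
  · dsimp only [f]
    split_ifs
    · exact hg0 i w
    · positivity
  · by_cases hw : ∑ j, g j w = 1
    · simp only [f, if_pos hw, hw]
    · simp [f, if_neg hw, hn0]
  · rw [← hgint i]
    exact integral_congr_ae (hfg.mono fun w hw => hw i)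
  · refine le_trans (le_of_eq (lintegral_congr_ae (hfg.mono fun w hw => ?_))) hgcost
    simp only [hw]

theorem exists_weights_of_wassDist_lt {X : Type*} [MeasurableSpace X] [MetricSpace X]
    [PolishSpace X] [BorelSpace X] {n : ℕ} (hn : 0 < n) (x : Fin n → X) {P : Measure X}
    [IsProbabilityMeasure P] {R : ℝ≥0∞} (h : wassDist dist P (empMeasure x) < R) :
    ∃ f : Fin n → X → ℝ, (∀ i, Measurable (f i)) ∧ (∀ i w, 0 ≤ f i w) ∧ (∀ w, ∑ i, f i w = 1) ∧
      (∀ i, ∫ w, f i w ∂P = (n : ℝ)⁻¹) ∧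
      ∫⁻ w, ENNReal.ofReal (∑ i, f i w * dist w (x i)) ∂P ≤ R := by
  simp only [wassDist, iInf_lt_iff] at h
  obtain ⟨Γ, h1, h2, h3⟩ := h
  obtain ⟨f, hm, h0, hs, hi, hc⟩ := exists_weights_of_coupling hn x h1 h2
  exact ⟨f, hm, h0, hs, hi, hc.trans h3.le⟩

theorem sum_integral_mul_le {X ι : Type*} [MeasurableSpace X] [Fintype ι]
    {P : Measure X} [IsProbabilityMeasure P] {u : ι → X → ℝ} {d : ι → ℝ} {D : X → ℝ} {R : ℝ}
    (hR : 0 ≤ R) (hu : ∀ i, Integrable (u i) P) (hu0 : ∀ i w, 0 ≤ u i w) (hd : ∀ i, 0 ≤ d i)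
    (hD : ∀ w, ∑ i, u i w * d i ≤ D w)
    (hDR : ∫⁻ w, ENNReal.ofReal (D w) ∂P ≤ ENNReal.ofReal R) :
    ∑ i, (∫ w, u i w ∂P) * d i ≤ R := by
  have h : ∑ i, (∫ w, u i w ∂P) * d i = ∫ w, ∑ i, u i w * d i ∂P := by
    rw [integral_finsetSum _ fun i _ => (hu i).mul_const _]
    simp only [integral_mul_const]
  rw [h, ← ENNReal.ofReal_le_ofReal_iff hR, ofReal_integral_eq_lintegral_ofReal
    (integrable_finsetSum _ fun i _ => (hu i).mul_const _)
    (ae_of_all _ fun w => Finset.sum_nonneg fun i _ => mul_nonneg (hu0 i w) (hd i))]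
  exact (lintegral_mono fun w => ENNReal.ofReal_le_ofReal (hD w)).trans hDR

/-- Two couplings, of `μ` with the `x i` and of `ν` with the `y j`, can be rerouted simultaneously
so that all mass ends up on the points `x i`, `y j`, without increasing the costs or the
divergence. -/
theorem exists_progFeasible_of_weights {X : Type*} [MeasurableSpace X] [MetricSpace X]
    [PolishSpace X] [BorelSpace X] {n1 n2 : ℕ} (x : Fin n1 → X) (y : Fin n2 → X)
    {μ ν : Measure X} [IsProbabilityMeasure μ] [IsProbabilityMeasure ν] (hac : ν ≪ μ)
    (hllr : Integrable (llr ν μ) ν) {R1 R2 : ℝ} (hR1 : 0 ≤ R1) (hR2 : 0 ≤ R2)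
    {f : Fin n1 → X → ℝ} (hfm : ∀ i, Measurable (f i)) (hf0 : ∀ i w, 0 ≤ f i w)
    (hf1 : ∀ w, ∑ i, f i w = 1) (hfi : ∀ i, ∫ w, f i w ∂μ = (n1 : ℝ)⁻¹)
    (hfc : ∫⁻ w, ENNReal.ofReal (∑ i, f i w * dist w (x i)) ∂μ ≤ ENNReal.ofReal R1)
    {g : Fin n2 → X → ℝ} (hgm : ∀ i, Measurable (g i)) (hg0 : ∀ i w, 0 ≤ g i w)
    (hg1 : ∀ w, ∑ i, g i w = 1) (hgi : ∀ i, ∫ w, g i w ∂ν = (n2 : ℝ)⁻¹)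
    (hgc : ∫⁻ w, ENNReal.ofReal (∑ i, g i w * dist w (y i)) ∂ν ≤ ENNReal.ofReal R2) :
    ∃ p1 p2 Γ1 Γ2, progFeasible x y R1 R2 p1 p2 Γ1 Γ2 ∧
      progObj p1 p2 ≤ ((∫ w, llr ν μ w ∂ν : ℝ) : EReal) := by
  let t : Fin n1 → Fin n2 → X → ℝ := fun i j w => dist w (x i) / (dist w (x i) + dist w (y j))
  have htm : ∀ i j, Measurable (t i j) := fun i j => by
    have h1 : Measurable fun w => dist w (x i) := measurable_id.dist measurable_const
    have h2 : Measurable fun w => dist w (y j) := measurable_id.dist measurable_const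
    exact h1.div (h1.add h2)
  have ht0 : ∀ i j w, 0 ≤ t i j w := fun i j w => by positivity
  have ht1 : ∀ i j w, t i j w ≤ 1 := fun i j w =>
    div_le_one_of_le₀ (le_add_of_nonneg_right dist_nonneg) (by positivity)
  have htri : ∀ i j w, dist (x i) (y j) ≤ dist w (x i) + dist w (y j) := fun i j w =>
    dist_triangle_left _ _ _
  have htx : ∀ i j w, t i j w * dist (x i) (y j) ≤ dist w (x i) := fun i j w => by
    refine (mul_le_mul_of_nonneg_left (htri i j w) (ht0 i j w)).trans ?_
    rcases (add_nonneg (dist_nonneg : 0 ≤ dist w (x i))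
      (dist_nonneg : 0 ≤ dist w (y j))).eq_or_lt with h | h
    · simp [← h]
    · rw [div_mul_cancel₀ _ h.ne']
  have hty : ∀ i j w, (1 - t i j w) * dist (x i) (y j) ≤ dist w (y j) := fun i j w => by
    refine (mul_le_mul_of_nonneg_left (htri i j w) (sub_nonneg.2 (ht1 i j w))).trans ?_
    have h0 : 0 ≤ dist w (x i) := dist_nonneg
    have h0' : 0 ≤ dist w (y j) := dist_nonneg
    rcases (add_nonneg h0 h0').eq_or_lt with h | h
    · simp [← h]
    · rw [sub_mul, one_mul, div_mul_cancel₀ _ h.ne']; linarith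
  let a : Fin n1 → Fin n2 → X → ℝ := fun i j w => f i w * g j w * (1 - t i j w)
  let b : Fin n1 → Fin n2 → X → ℝ := fun i j w => f i w * g j w * t i j w
  have ham : ∀ i j, Measurable (a i j) := fun i j =>
    ((hfm i).mul (hgm j)).mul (measurable_const.sub (htm i j))
  have hbm : ∀ i j, Measurable (b i j) := fun i j => ((hfm i).mul (hgm j)).mul (htm i j)
  have ha0 : ∀ i j w, 0 ≤ a i j w := fun i j w =>
    mul_nonneg (mul_nonneg (hf0 i w) (hg0 j w)) (sub_nonneg.2 (ht1 i j w))
  have hb0 : ∀ i j w, 0 ≤ b i j w := fun i j w =>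
    mul_nonneg (mul_nonneg (hf0 i w) (hg0 j w)) (ht0 i j w)
  have habf : ∀ i w, ∑ j, (a i j w + b i j w) = f i w := fun i w => by
    have : ∀ j, a i j w + b i j w = f i w * g j w := fun j => by simp only [a, b]; ring
    simp only [this, ← Finset.mul_sum, hg1, mul_one]
  have habg : ∀ j w, ∑ i, (a i j w + b i j w) = g j w := fun j w => by
    have : ∀ i, a i j w + b i j w = f i w * g j w := fun i => by simp only [a, b]; ring
    simp only [this, ← Finset.sum_mul, hf1, one_mul]
  have hab1 : ∀ i j w, a i j w + b i j w ≤ 1 := fun i j w => by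
    have h1 : a i j w + b i j w ≤ f i w := by
      rw [← habf i w]
      exact Finset.single_le_sum (f := fun j => a i j w + b i j w)
        (fun j _ => add_nonneg (ha0 i j w) (hb0 i j w)) (Finset.mem_univ j)
    refine h1.trans ?_
    rw [← hf1 w]
    exact Finset.single_le_sum (f := fun i => f i w) (fun i _ => hf0 i w) (Finset.mem_univ i)
  have hai : ∀ (P : Measure X) [IsProbabilityMeasure P] i j, Integrable (a i j) P :=
    fun P _ i j => Integrable.of_mem_Icc 0 1 (ham i j).aemeasurable (ae_of_all _ fun w =>
      ⟨ha0 i j w, (le_add_of_nonneg_right (hb0 i j w)).trans (hab1 i j w)⟩)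
  have hbi : ∀ (P : Measure X) [IsProbabilityMeasure P] i j, Integrable (b i j) P :=
    fun P _ i j => Integrable.of_mem_Icc 0 1 (hbm i j).aemeasurable (ae_of_all _ fun w =>
      ⟨hb0 i j w, (le_add_of_nonneg_left (ha0 i j w)).trans (hab1 i j w)⟩)
  have hA0 : ∀ (P : Measure X) i j, 0 ≤ ∫ w, a i j w ∂P := fun P i j =>
    integral_nonneg fun w => ha0 i j w
  have hB0 : ∀ (P : Measure X) i j, 0 ≤ ∫ w, b i j w ∂P := fun P i j =>
    integral_nonneg fun w => hb0 i j w
  let k : Fin (n1 + n2) → X → ℝ :=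
    Fin.addCases (fun i w => ∑ j, a i j w) (fun j w => ∑ i, b i j w)
  have hkl : ∀ i, k (Fin.castAdd n2 i) = fun w => ∑ j, a i j w := fun i => by simp [k]
  have hkr : ∀ j, k (Fin.natAdd n1 j) = fun w => ∑ i, b i j w := fun j => by simp [k]
  have hkm : ∀ l, Measurable (k l) := by
    refine fun l => Fin.addCases (fun i => ?_) (fun j => ?_) l
    · rw [hkl]; exact Finset.measurable_sum _ fun j _ => ham i j
    · rw [hkr]; exact Finset.measurable_sum _ fun i _ => hbm i j
  have hk0 : ∀ l w, 0 ≤ k l w := by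
    refine fun l w => Fin.addCases (fun i => ?_) (fun j => ?_) l
    · rw [hkl]; exact Finset.sum_nonneg fun j _ => ha0 i j w
    · rw [hkr]; exact Finset.sum_nonneg fun i _ => hb0 i j w
  have hk1 : ∀ w, ∑ l, k l w = 1 := fun w => by
    rw [Fin.sum_univ_add]
    simp only [hkl, hkr]
    rw [Finset.sum_comm (f := fun j i => b i j w), ← Finset.sum_add_distrib, ← hf1 w]
    simp only [← Finset.sum_add_distrib, habf]
  let Γ1 : Fin (n1 + n2) → Fin (n1 + n2) → ℝ := Fin.addCases
    (fun i => Fin.addCases (fun i' => if i = i' then ∑ j, ∫ w, a i j w ∂μ else 0)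
      (fun j => ∫ w, b i j w ∂μ)) (fun _ _ => 0)
  let Γ2 : Fin (n1 + n2) → Fin (n1 + n2) → ℝ := Fin.addCases (fun _ _ => 0)
    (fun j => Fin.addCases (fun i => ∫ w, a i j w ∂ν)
      (fun j' => if j = j' then ∑ i, ∫ w, b i j w ∂ν else 0))
  refine ⟨fun l => ∫ w, k l w ∂μ, fun l => ∫ w, k l w ∂ν, Γ1, Γ2,
    ⟨fun l => integral_nonneg (hk0 l), fun l => integral_nonneg (hk0 l), ?_, ?_, ?_, ?_, ?_, ?_,
      ?_, ?_⟩, ?_⟩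
  · refine fun l m => Fin.addCases (fun i => ?_) (fun j => ?_) l
    · refine Fin.addCases (fun i' => ?_) (fun j => ?_) m
      · simp only [Γ1, Fin.addCases_left]
        split_ifs
        exacts [Finset.sum_nonneg fun j _ => hA0 μ i j, le_rfl]
      · simpa [Γ1] using hB0 μ i j
    · simp [Γ1]
  · refine fun l m => Fin.addCases (fun i => ?_) (fun j => ?_) l
    · simp [Γ2]
    · refine Fin.addCases (fun i => ?_) (fun j' => ?_) m
      · simpa [Γ2] using hA0 ν i j
      · simp only [Γ2, Fin.addCases_right]
        split_ifs
        exacts [Finset.sum_nonneg fun i _ => hB0 ν i j, le_rfl]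
  · have h := sum_integral_mul_le (ι := Fin n1 × Fin n2) (u := fun p => b p.1 p.2)
      (d := fun p => dist (x p.1) (y p.2)) (D := fun w => ∑ i, f i w * dist w (x i)) hR1
      (fun p => hbi μ p.1 p.2) (fun p => hb0 p.1 p.2) (fun p => dist_nonneg) (fun w => ?_) hfc
    · rw [Fintype.sum_prod_type] at h
      simpa [Γ1, Fin.sum_univ_add, ite_mul] using h
    · rw [Fintype.sum_prod_type]
      refine Finset.sum_le_sum fun i _ => ?_
      calc ∑ j, b i j w * dist (x i) (y j) ≤ ∑ j, f i w * dist w (x i) * g j w := by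
            refine Finset.sum_le_sum fun j _ => ?_
            have := mul_le_mul_of_nonneg_left (htx i j w) (mul_nonneg (hf0 i w) (hg0 j w))
            simp only [b]
            linarith
        _ = _ := by rw [← Finset.mul_sum, hg1, mul_one]
  · have h := sum_integral_mul_le (ι := Fin n2 × Fin n1) (u := fun p => a p.2 p.1)
      (d := fun p => dist (y p.1) (x p.2)) (D := fun w => ∑ j, g j w * dist w (y j)) hR2
      (fun p => hai ν p.2 p.1) (fun p => ha0 p.2 p.1) (fun p => dist_nonneg) (fun w => ?_) hgc
    · rw [Fintype.sum_prod_type] at h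
      simpa [Γ2, Fin.sum_univ_add, ite_mul] using h
    · rw [Fintype.sum_prod_type]
      refine Finset.sum_le_sum fun j _ => ?_
      calc ∑ i, a i j w * dist (y j) (x i) ≤ ∑ i, f i w * (g j w * dist w (y j)) := by
            refine Finset.sum_le_sum fun i _ => ?_
            have := mul_le_mul_of_nonneg_left (hty i j w) (mul_nonneg (hf0 i w) (hg0 j w))
            rw [dist_comm (y j)]
            simp only [a]
            linarith
        _ = _ := by rw [← Finset.sum_mul, hf1, one_mul]
  · refine fun l => Fin.addCases (fun i => ?_) (fun j => ?_) l
    · simp only [Γ1, Fin.sum_univ_add, Fin.addCases_left, Fin.addCases_right,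
        Finset.sum_ite_eq, Finset.mem_univ, if_true, Fin.val_castAdd, i.isLt]
      rw [← hfi i, ← Finset.sum_add_distrib]
      simp only [← integral_add (hai μ i _) (hbi μ i _)]
      refine (integral_finsetSum _ fun j _ => (hai μ i j).add (hbi μ i j)).symm.trans ?_
      simp only [Pi.add_apply, habf]
    · simp [Γ1]
  · refine fun l => Fin.addCases (fun i => ?_) (fun j => ?_) l
    · simp [Γ2]
    · simp only [Γ2, Fin.sum_univ_add, Fin.addCases_left, Fin.addCases_right,
        Finset.sum_ite_eq, Finset.mem_univ, if_true, Fin.val_natAdd,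
        not_lt.2 (Nat.le_add_right n1 _), if_false]
      rw [← hgi j, ← Finset.sum_add_distrib]
      simp only [← integral_add (hai ν _ j) (hbi ν _ j)]
      refine (integral_finsetSum _ fun i _ => (hai ν i j).add (hbi ν i j)).symm.trans ?_
      simp only [Pi.add_apply, habg]
  · refine fun l => Fin.addCases (fun i => ?_) (fun j => ?_) l
    · beta_reduce
      rw [hkl, integral_finsetSum _ fun j _ => hai μ i j]
      simp [Γ1, Fin.sum_univ_add]
    · beta_reduce
      rw [hkr, integral_finsetSum _ fun i _ => hbi μ i j]
      simp [Γ1, Fin.sum_univ_add]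
  · refine fun l => Fin.addCases (fun i => ?_) (fun j => ?_) l
    · beta_reduce
      rw [hkl, integral_finsetSum _ fun j _ => hai ν i j]
      simp [Γ2, Fin.sum_univ_add]
    · beta_reduce
      rw [hkr, integral_finsetSum _ fun i _ => hbi ν i j]
      simp [Γ2, Fin.sum_univ_add]
  · rw [progObj_eq_sum_klTerm (fun l => integral_nonneg (hk0 l)) fun l => integral_nonneg (hk0 l)]
    exact sum_klTerm_integral_le hac hllr hkm hk0 hk1

/-- The measure with weights `p l` at the points `z l`. -/
def atomicMeasure {X ι : Type*} [MeasurableSpace X] [Fintype ι] (z : ι → X) (p : ι → ℝ) :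
    Measure X :=
  ∑ l, ENNReal.ofReal (p l) • Measure.dirac (z l)

section AtomicMeasure

variable {X ι : Type*} [MeasurableSpace X] [Fintype ι] {z : ι → X} {p : ι → ℝ}

theorem atomicMeasure_apply {s : Set X} (hs : MeasurableSet s) :
    atomicMeasure z p s = ∑ l, ENNReal.ofReal (p l) * s.indicator 1 (z l) := by
  simp [atomicMeasure, Measure.dirac_apply' _ hs]

theorem isProbabilityMeasure_atomicMeasure (hp : ∀ l, 0 ≤ p l) (h1 : ∑ l, p l = 1) :
    IsProbabilityMeasure (atomicMeasure z p) :=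
  ⟨by simp [atomicMeasure, ← ENNReal.ofReal_sum_of_nonneg fun l _ => hp l, h1]⟩

variable [MeasurableSingletonClass X]

theorem integrable_atomicMeasure (F : X → ℝ) : Integrable F (atomicMeasure z p) := by
  refine integrable_finsetSum_measure.2 fun l _ => Integrable.smul_measure ?_ ENNReal.ofReal_ne_top
  exact integrable_dirac (by simp)

theorem integral_atomicMeasure (hp : ∀ l, 0 ≤ p l) (F : X → ℝ) :
    ∫ w, F w ∂atomicMeasure z p = ∑ l, p l * F (z l) := by
  rw [atomicMeasure, integral_finsetSum_measure fun l _ =>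
    Integrable.smul_measure (integrable_dirac (by simp)) ENNReal.ofReal_ne_top]
  refine Finset.sum_congr rfl fun l _ => ?_
  rw [integral_smul_measure, integral_dirac, ENNReal.toReal_ofReal (hp l), smul_eq_mul]

theorem of_ae_atomicMeasure {Q : X → Prop} (h : ∀ᵐ w ∂atomicMeasure z p, Q w) {l : ι}
    (hl : 0 < p l) : Q (z l) := by
  by_contra hQ
  have h0 : atomicMeasure z p {z l} = 0 := measure_mono_null (by simpa using hQ) (ae_iff.1 h)
  rw [atomicMeasure_apply (measurableSet_singleton _), Finset.sum_eq_zero_iff] at h0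
  have := h0 l (Finset.mem_univ l)
  simp [hl.not_ge] at this

end AtomicMeasure

theorem KLdiv_atomicMeasure_le {X : Type*} [MeasurableSpace X] [MeasurableSingletonClass X]
    {n : ℕ} (z : Fin n → X) {p1 p2 : Fin n → ℝ} (h1 : ∀ l, 0 ≤ p1 l) (h2 : ∀ l, 0 ≤ p2 l)
    (hs1 : ∑ l, p1 l = 1) (hs2 : ∑ l, p2 l = 1) :
    KLdiv (atomicMeasure z p2) (atomicMeasure z p1) ≤ progObj p1 p2 := by
  by_cases hex : ∃ l, p1 l = 0 ∧ p2 l ≠ 0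
  · obtain ⟨l, hl1, hl2⟩ := hex
    rw [progObj_eq_top h1 h2 hl1 hl2]
    exact le_top
  push Not at hex
  have hP1 := isProbabilityMeasure_atomicMeasure (z := z) h1 hs1
  have hP2 := isProbabilityMeasure_atomicMeasure (z := z) h2 hs2
  have hobj : progObj p1 p2 = ((∑ l, p2 l * log (p2 l / p1 l) : ℝ) : EReal) := by
    rw [coe_sum_ereal]
    refine Finset.sum_congr rfl fun l _ => ?_
    by_cases hl : p2 l = 0
    · simp [hl]
    · rw [if_neg hl, if_neg fun h => hl (hex l h)]
  have hac : atomicMeasure z p2 ≪ atomicMeasure z p1 := by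
    refine Measure.AbsolutelyContinuous.mk fun s hs h => ?_
    rw [atomicMeasure_apply hs, Finset.sum_eq_zero_iff] at h ⊢
    intro l hl
    rcases mul_eq_zero.1 (h l hl) with h' | h'
    · rw [hex l (le_antisymm (ENNReal.ofReal_eq_zero.1 h') (h1 l))]
      simp
    · rw [h', mul_zero]
  rw [KLdiv, if_pos ⟨hac, integrable_atomicMeasure _⟩, hobj, EReal.coe_le_coe_iff,
    integral_atomicMeasure h2]
  let h : X → ℝ := fun w => ((atomicMeasure z p2).rnDeriv (atomicMeasure z p1) w).toReal
  have hpos : ∀ᵐ w ∂atomicMeasure z p2, 0 < h w := by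
    filter_upwards [Measure.rnDeriv_pos hac,
      hac.ae_le (Measure.rnDeriv_lt_top (atomicMeasure z p2) (atomicMeasure z p1))] with w hw hw'
    exact ENNReal.toReal_pos hw.ne' hw'.ne
  have hsum : ∑ l, p1 l * h (z l) = 1 := by
    rw [← integral_atomicMeasure h1 h]
    exact (Measure.integral_toReal_rnDeriv hac).trans (by simp)
  have hterm : ∀ l, p2 l * llr (atomicMeasure z p2) (atomicMeasure z p1) (z l) ≤
      p2 l * log (p2 l / p1 l) + (p1 l * h (z l) - p2 l) := by
    intro l
    rcases (h2 l).eq_or_lt with hl | hl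
    · simpa [← hl] using mul_nonneg (h1 l) toReal_nonneg
    · have hl1 : 0 < p1 l := (h1 l).lt_of_ne' fun h' => hl.ne' (hex l h')
      have h3 := mul_le_mul_of_nonneg_left
        (mul_one_add_sub_le_exp (div_pos hl hl1).le (log (h (z l)))) hl1.le
      rw [exp_log (of_ae_atomicMeasure hpos hl), ← mul_assoc, mul_div_cancel₀ _ hl1.ne'] at h3
      change p2 l * log (h (z l)) ≤ _
      linarith
  calc _ ≤ ∑ l, (p2 l * log (p2 l / p1 l) + (p1 l * h (z l) - p2 l)) :=
        Finset.sum_le_sum fun l _ => hterm l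
    _ = _ := by rw [Finset.sum_add_distrib, Finset.sum_sub_distrib, hsum, hs2]; ring

theorem wassDist_atomicMeasure_le {X ι : Type*} [MeasurableSpace X] [MetricSpace X] [PolishSpace X]
    [BorelSpace X] [Fintype ι] (z : ι → X) {G : ι → ι → ℝ} (hG : ∀ l m, 0 ≤ G l m) {r : ℝ}
    (hr : ∑ l, ∑ m, G l m * dist (z l) (z m) ≤ r) :
    wassDist dist (atomicMeasure z fun m => ∑ l, G l m) (atomicMeasure z fun l => ∑ m, G l m) ≤
      ENNReal.ofReal r := by
  let Γ : Measure (X × X) :=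
    atomicMeasure (fun p : ι × ι => (z p.2, z p.1)) (fun p => G p.1 p.2)
  have h1 : Γ.map Prod.fst = atomicMeasure z fun m => ∑ l, G l m := by
    ext s hs
    rw [Measure.map_apply measurable_fst hs, atomicMeasure_apply (measurable_fst hs),
      atomicMeasure_apply hs, Fintype.sum_prod_type_right]
    refine Finset.sum_congr rfl fun m _ => ?_
    rw [ENNReal.ofReal_sum_of_nonneg fun l _ => hG l m, Finset.sum_mul]
    rfl
  have h2 : Γ.map Prod.snd = atomicMeasure z fun l => ∑ m, G l m := by
    ext s hs
    rw [Measure.map_apply measurable_snd hs, atomicMeasure_apply (measurable_snd hs),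
      atomicMeasure_apply hs, Fintype.sum_prod_type]
    refine Finset.sum_congr rfl fun l _ => ?_
    rw [ENNReal.ofReal_sum_of_nonneg fun m _ => hG l m, Finset.sum_mul]
    rfl
  refine (iInf_le_of_le Γ (iInf_le_of_le h1 (iInf_le _ h2))).trans ?_
  rw [← ofReal_integral_eq_lintegral_ofReal (integrable_atomicMeasure _)
    (ae_of_all _ fun _ => dist_nonneg), integral_atomicMeasure
    (p := fun p : ι × ι => G p.1 p.2) fun p => hG p.1 p.2]
  refine ENNReal.ofReal_le_ofReal ?_
  rw [Fintype.sum_prod_type]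
  simpa only [dist_comm] using hr

theorem empMeasure_eq_atomicMeasure_left {X : Type*} [MeasurableSpace X] {n1 n2 : ℕ} (hn : 0 < n1)
    (x : Fin n1 → X) (y : Fin n2 → X) :
    empMeasure x = atomicMeasure (Fin.append x y)
      (fun l : Fin (n1 + n2) => if (l : ℕ) < n1 then (n1 : ℝ)⁻¹ else 0) := by
  have : (0 : ℝ) < n1 := by exact_mod_cast hn
  simp [empMeasure, atomicMeasure, Fin.sum_univ_add, Finset.smul_sum, ENNReal.ofReal_inv_of_pos this]

theorem empMeasure_eq_atomicMeasure_right {X : Type*} [MeasurableSpace X] {n1 n2 : ℕ} (hn : 0 < n2)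
    (x : Fin n1 → X) (y : Fin n2 → X) :
    empMeasure y = atomicMeasure (Fin.append x y)
      (fun l : Fin (n1 + n2) => if (l : ℕ) < n1 then 0 else (n2 : ℝ)⁻¹) := by
  have : (0 : ℝ) < n2 := by exact_mod_cast hn
  simp [empMeasure, atomicMeasure, Fin.sum_univ_add, Finset.smul_sum, ENNReal.ofReal_inv_of_pos this]

theorem exists_mem_klBallValues_le {X : Type*} [MeasurableSpace X] [MetricSpace X] [PolishSpace X]
    [BorelSpace X] {n1 n2 : ℕ} (hn1 : 0 < n1) (hn2 : 0 < n2) (x : Fin n1 → X) (y : Fin n2 → X)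
    {r1 r2 : ℝ} {e : EReal} (he : e ∈ progValues x y r1 r2) :
    ∃ e' ∈ klBallValues x y r1 r2, e' ≤ e := by
  obtain ⟨p1, p2, Γ1, Γ2, ⟨hp1, hp2, hΓ1, hΓ2, hc1, hc2, hrow1, hrow2, hcol1, hcol2⟩, rfl⟩ := he
  have hs1 : ∑ l, p1 l = 1 := by
    simp only [← hcol1]
    rw [Finset.sum_comm]
    simp [hrow1, Fin.sum_univ_add, hn1.ne']
  have hs2 : ∑ l, p2 l = 1 := by
    simp only [← hcol2]
    rw [Finset.sum_comm]
    simp [hrow2, Fin.sum_univ_add, hn2.ne']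
  have hw1 := wassDist_atomicMeasure_le (Fin.append x y) hΓ1 hc1
  have hw2 := wassDist_atomicMeasure_le (Fin.append x y) hΓ2 hc2
  simp only [hrow1, hcol1, ← empMeasure_eq_atomicMeasure_left hn1 x y] at hw1
  simp only [hrow2, hcol2, ← empMeasure_eq_atomicMeasure_right hn2 x y] at hw2
  exact ⟨_, ⟨_, _, isProbabilityMeasure_atomicMeasure hp1 hs1,
    isProbabilityMeasure_atomicMeasure hp2 hs2, hw1, hw2, rfl⟩,
    KLdiv_atomicMeasure_le _ hp1 hp2 hs1 hs2⟩

theorem isCompact_nonneg_rowSum {ι : Type*} [Fintype ι] (w : ι → ℝ) :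
    IsCompact {G : ι → ι → ℝ | (∀ l m, 0 ≤ G l m) ∧ ∀ l, ∑ m, G l m = w l} := by
  refine (isCompact_Icc (a := (0 : ι → ι → ℝ)) (b := fun l _ => w l)).of_isClosed_subset ?_ ?_
  · simp only [ofPred_and, ofPred_forall]
    refine IsClosed.inter (isClosed_iInter fun l => isClosed_iInter fun m => ?_)
      (isClosed_iInter fun l => ?_)
    · exact isClosed_le continuous_const (by fun_prop)
    · exact isClosed_eq (by fun_prop) continuous_const
  · rintro G ⟨h0, hs⟩
    refine ⟨fun l m => h0 l m, fun l m => ?_⟩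
    beta_reduce
    rw [← hs l]
    exact Finset.single_le_sum (fun m _ => h0 l m) (Finset.mem_univ m)

/-- **Theorem 1 (LFD), reduction to a finite-dimensional program.**
The infimum of `KL(ν‖μ)` over the Wasserstein balls
`W(μ, μ0) ≤ r1`, `W(ν, ν0) ≤ r2` around the empirical measures `μ0, ν0` equals the optimal value
of the finite-dimensional convex program, and the latter minimum is attained. -/
theorem robust_kl_min_eq_finite_program
    {X : Type*} [MeasurableSpace X] [MetricSpace X] [PolishSpace X] [BorelSpace X]
    {n1 n2 : ℕ} (hn1 : 0 < n1) (hn2 : 0 < n2)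
    (x : Fin n1 → X) (y : Fin n2 → X) {r1 r2 : ℝ} (hr1 : 0 ≤ r1) (hr2 : 0 ≤ r2) :
    sInf (klBallValues x y r1 r2) = sInf (progValues x y r1 r2) ∧
    ∃ e ∈ progValues x y r1 r2, e = sInf (progValues x y r1 r2) := by
  let z := Fin.append x y
  let w1 : Fin (n1 + n2) → ℝ := fun l => if (l : ℕ) < n1 then (n1 : ℝ)⁻¹ else 0
  let w2 : Fin (n1 + n2) → ℝ := fun l => if (l : ℕ) < n1 then 0 else (n2 : ℝ)⁻¹
  let T := Fin (n1 + n2) → Fin (n1 + n2) → ℝ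
  let K : Set (T × T) := {G : T | (∀ l m, 0 ≤ G l m) ∧ ∀ l, ∑ m, G l m = w1 l} ×ˢ
    {G : T | (∀ l m, 0 ≤ G l m) ∧ ∀ l, ∑ m, G l m = w2 l}
  have hK : IsCompact K := (isCompact_nonneg_rowSum w1).prod (isCompact_nonneg_rowSum w2)
  let C1 : T × T → ℝ := fun G => ∑ l, ∑ m, G.1 l m * dist (z l) (z m)
  let C2 : T × T → ℝ := fun G => ∑ l, ∑ m, G.2 l m * dist (z l) (z m)
  have hC1 : Continuous C1 := by dsimp only [C1, T]; fun_prop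
  have hC2 : Continuous C2 := by dsimp only [C2, T]; fun_prop
  let F : T × T → EReal := fun G => ∑ m, klTerm (∑ l, G.1 l m) (∑ l, G.2 l m)
  have hF : LowerSemicontinuous F := lowerSemicontinuous_sum_klTerm Finset.univ
    (a := fun m (G : T × T) => ∑ l, G.1 l m) (b := fun m (G : T × T) => ∑ l, G.2 l m)
    (fun m => by dsimp only [T]; fun_prop) (fun m => by dsimp only [T]; fun_prop)
  have hmem : ∀ ρ1 ρ2 e, e ∈ progValues x y ρ1 ρ2 ↔
      ∃ G ∈ K, C1 G ≤ ρ1 ∧ C2 G ≤ ρ2 ∧ F G = e := by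
    intro ρ1 ρ2 e
    constructor
    · rintro ⟨p1, p2, Γ1, Γ2, ⟨hp1, hp2, hΓ1, hΓ2, hc1, hc2, hrow1, hrow2, hcol1, hcol2⟩, rfl⟩
      refine ⟨(Γ1, Γ2), ⟨⟨hΓ1, hrow1⟩, ⟨hΓ2, hrow2⟩⟩, hc1, hc2, ?_⟩
      simp only [F, hcol1, hcol2, progObj_eq_sum_klTerm hp1 hp2]
    · rintro ⟨G, ⟨⟨hG1, hrow1⟩, ⟨hG2, hrow2⟩⟩, hc1, hc2, rfl⟩
      have hp1 : ∀ m, 0 ≤ ∑ l, G.1 l m := fun m => Finset.sum_nonneg fun l _ => hG1 l m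
      have hp2 : ∀ m, 0 ≤ ∑ l, G.2 l m := fun m => Finset.sum_nonneg fun l _ => hG2 l m
      exact ⟨_, _, G.1, G.2, ⟨hp1, hp2, hG1, hG2, hc1, hc2, hrow1, hrow2, fun _ => rfl,
        fun _ => rfl⟩, (progObj_eq_sum_klTerm hp1 hp2).symm⟩
  refine ⟨le_antisymm (le_sInf fun e he => ?_) (le_sInf ?_), ?_⟩
  · obtain ⟨e', he', hle⟩ := exists_mem_klBallValues_le hn1 hn2 x y he
    exact (sInf_le he').trans hle
  · rintro _ ⟨μ, ν, hμ, hν, hWμ, hWν, rfl⟩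
    rw [KLdiv]
    split_ifs with h
    swap
    · exact le_top
    have happrox : ∀ ε > 0, ∃ G ∈ K, C1 G ≤ r1 + ε ∧ C2 G ≤ r2 + ε ∧
        F G ≤ ((∫ a, llr ν μ a ∂ν : ℝ) : EReal) := by
      intro ε hε
      have hlt1 := hWμ.trans_lt ((ENNReal.ofReal_lt_ofReal_iff (by linarith)).2
        (lt_add_of_pos_right r1 hε))
      have hlt2 := hWν.trans_lt ((ENNReal.ofReal_lt_ofReal_iff (by linarith)).2
        (lt_add_of_pos_right r2 hε))
      obtain ⟨f, hfm, hf0, hf1, hfi, hfc⟩ := exists_weights_of_wassDist_lt hn1 x hlt1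
      obtain ⟨g, hgm, hg0, hg1, hgi, hgc⟩ := exists_weights_of_wassDist_lt hn2 y hlt2
      obtain ⟨p1, p2, Γ1, Γ2, hfeas, hle⟩ := exists_progFeasible_of_weights x y h.1 h.2
        (by linarith) (by linarith) hfm hf0 hf1 hfi hfc hgm hg0 hg1 hgi hgc
      obtain ⟨G, hG, hG1, hG2, hGF⟩ := (hmem _ _ _).1 ⟨p1, p2, Γ1, Γ2, hfeas, rfl⟩
      exact ⟨G, hG, hG1, hG2, hGF.trans_le hle⟩
    obtain ⟨G₁, hG₁, -, -, hFG₁⟩ := happrox 1 one_pos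
    obtain ⟨G, ⟨hGK, hGF⟩, hGmin⟩ := (hK.inter_right (hF.isClosed_preimage _)).exists_isMinOn
      ⟨G₁, hG₁, hFG₁⟩ ((hC1.sub continuous_const).max (hC2.sub continuous_const)).continuousOn
      (f := fun G => max (C1 G - r1) (C2 G - r2))
    have hG0 : max (C1 G - r1) (C2 G - r2) ≤ 0 := by
      refine le_of_forall_pos_le_add fun ε hε => ?_
      obtain ⟨G', hG', h1, h2, h3⟩ := happrox ε hε
      refine (isMinOn_iff.1 hGmin G' ⟨hG', h3⟩).trans (max_le ?_ ?_) <;> linarith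
    have hle1 := (le_max_left _ _).trans hG0
    have hle2 := (le_max_right _ _).trans hG0
    exact (sInf_le ((hmem _ _ _).2 ⟨G, hGK, by linarith, by linarith, rfl⟩)).trans hGF
  · have hS : IsCompact (K ∩ {G | C1 G ≤ r1 ∧ C2 G ≤ r2}) := hK.inter_right
      ((isClosed_le hC1 continuous_const).inter (isClosed_le hC2 continuous_const))
    have hw1 : ∀ l, 0 ≤ w1 l := fun l => by dsimp only [w1]; positivity
    have hw2 : ∀ l, 0 ≤ w2 l := fun l => by dsimp only [w2]; positivity
    have hne : (K ∩ {G | C1 G ≤ r1 ∧ C2 G ≤ r2}).Nonempty := by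
      refine ⟨(fun l m => if l = m then w1 l else 0, fun l m => if l = m then w2 l else 0),
        ⟨⟨fun l m => ?_, fun l => ?_⟩, ⟨fun l m => ?_, fun l => ?_⟩⟩, ?_, ?_⟩
      · dsimp only; split_ifs; exacts [hw1 l, le_rfl]
      · simp
      · dsimp only; split_ifs; exacts [hw2 l, le_rfl]
      · simp
      · simpa [C1, ite_mul] using hr1
      · simpa [C2, ite_mul] using hr2
    obtain ⟨G, ⟨hGK, hG1, hG2⟩, hGmin⟩ := (hF.lowerSemicontinuousOn _).exists_isMinOn hne hS
    have hG := (hmem r1 r2 _).2 ⟨G, hGK, hG1, hG2, rfl⟩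
    refine ⟨_, hG, le_antisymm (le_sInf fun e he => ?_) (sInf_le hG)⟩
    obtain ⟨G', hG'K, h1, h2, rfl⟩ := (hmem _ _ _).1 he
    exact isMinOn_iff.1 hGmin G' ⟨hG'K, h1, h2⟩
end
end

section
/- Let μ0 = (1/n1) Σ_{i=1}^{n1} δ_{x_i} be an empirical measure and let μ be any probability measure on X with W(μ, μ0) ≤ r. Then for every λ ≥ 0 and every vector u ∈ ℝ^{n1}: (1/n1) Σ_{i=1}^{n1} u^i + ∫_X min_{1≤i≤n1} ( λ·c(ξ, x_i) − u^i ) dμ(ξ) ≤ λ·r, where the integral is well defined since the integrand is bounded below by −max_i u^i and has finite positive part under the hypothesis W(μ,μ0) ≤ r. -/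
open MeasureTheory Real ENNReal

noncomputable section

/-- The integral of a continuous function with one-sided Lipschitz constant `K` changes by at
most `K` times the cost of any finite-cost coupling. -/
lemma integrable_and_integral_le_of_coupling
    {X : Type*} [MeasurableSpace X] [MetricSpace X] [SecondCountableTopology X] [BorelSpace X]
    {f : X → ℝ} (hf : Continuous f) {K : ℝ} (hK : ∀ a b, f a ≤ f b + K * dist a b)
    {P Q : Measure X} {Γ : Measure (X × X)} (hP : Γ.map Prod.fst = P) (hQ : Γ.map Prod.snd = Q)
    (hfin : ∫⁻ p, ENNReal.ofReal (dist p.1 p.2) ∂Γ ≠ ∞) (hfQ : Integrable f Q) :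
    Integrable f P ∧
      ∫ a, f a ∂P ≤
        ∫ b, f b ∂Q + K * (∫⁻ p, ENNReal.ofReal (dist p.1 p.2) ∂Γ).toReal := by
  subst hP hQ
  have hmeas : AEStronglyMeasurable (fun p : X × X => dist p.1 p.2) Γ :=
    continuous_dist.aestronglyMeasurable
  have hnonneg : 0 ≤ᵐ[Γ] fun p : X × X => dist p.1 p.2 := ae_of_all _ fun _ => dist_nonneg
  have hd : Integrable (fun p : X × X => dist p.1 p.2) Γ :=
    (lintegral_ofReal_ne_top_iff_integrable hmeas hnonneg).1 hfin
  have h2 : Integrable (fun p : X × X => f p.2) Γ :=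
    (integrable_map_measure hf.aestronglyMeasurable measurable_snd.aemeasurable).1 hfQ
  have h1 : Integrable (fun p : X × X => f p.1) Γ := by
    refine (h2.abs.add (hd.const_mul K)).mono'
      (hf.comp continuous_fst).aestronglyMeasurable (ae_of_all _ fun p => ?_)
    have h₁ := hK p.1 p.2
    have h₂ := hK p.2 p.1
    rw [dist_comm p.2 p.1] at h₂
    simp only [Pi.add_apply, Real.norm_eq_abs]
    rw [abs_le]
    constructor <;> linarith [le_abs_self (f p.2), neg_abs_le (f p.2)]
  refine ⟨(integrable_map_measure hf.aestronglyMeasurable measurable_fst.aemeasurable).2 h1, ?_⟩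
  rw [integral_map measurable_fst.aemeasurable hf.aestronglyMeasurable,
    integral_map measurable_snd.aemeasurable hf.aestronglyMeasurable,
    ← integral_eq_lintegral_of_nonneg_ae hnonneg hmeas, ← integral_const_mul,
    ← integral_add h2 (hd.const_mul K)]
  exact integral_mono h1 (h2.add (hd.const_mul K)) fun p => hK p.1 p.2

/-- A real function is integrable with respect to an empirical measure, with integral its mean. -/
lemma integrable_and_integral_empMeasure
    {X : Type*} [MeasurableSpace X] {n : ℕ} (hn : 0 < n) (x : Fin n → X)
    {f : X → ℝ} (hf : StronglyMeasurable f) :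
    Integrable f (empMeasure x) ∧
      ∫ a, f a ∂(empMeasure x) = (n : ℝ)⁻¹ * ∑ i, f (x i) := by
  have hdirac : ∀ i ∈ Finset.univ, Integrable f (Measure.dirac (x i)) := fun i _ =>
    ⟨hf.aestronglyMeasurable, by
      rw [hasFiniteIntegral_iff_enorm, lintegral_dirac' _ hf.enorm]; simp⟩
  refine ⟨(integrable_finsetSum_measure.2 hdirac).smul_measure (by simp [hn.ne']), ?_⟩
  rw [empMeasure, integral_smul_measure, integral_finsetSum_measure hdirac]
  simp [integral_dirac' _ _ hf]

/-- A finite minimum of shifted distance functions scaled by `K` is `K`-Lipschitz. -/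
lemma inf'_mul_dist_sub_le {X ι : Type*} [MetricSpace X] {s : Finset ι} (hs : s.Nonempty)
    (x : ι → X) (u : ι → ℝ) {K : ℝ} (hK : 0 ≤ K) (a b : X) :
    s.inf' hs (fun i => K * dist a (x i) - u i) ≤
      s.inf' hs (fun i => K * dist b (x i) - u i) + K * dist a b := by
  rw [← sub_le_iff_le_add]
  refine Finset.le_inf' _ _ fun i hi => ?_
  have h := Finset.inf'_le (fun i => K * dist a (x i) - u i) hi
  have := mul_le_mul_of_nonneg_left (dist_triangle a b (x i)) hK
  linarith

/-- **Dual feasibility bound over a Wasserstein ball.**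
If `μ0 = (1/n1) ∑ᵢ δ_{x_i}` and `μ` is a probability measure with `W(μ, μ0) ≤ r`, then for every
`λ ≥ 0` and `u ∈ ℝ^{n1}`, the function `ξ ↦ minᵢ (λ c(ξ, x_i) − uⁱ)` is `μ`-integrable (it is
bounded below by `−maxᵢ uⁱ` and has finite positive part) and
`(1/n1) ∑ᵢ uⁱ + ∫ minᵢ (λ c(ξ, x_i) − uⁱ) dμ(ξ) ≤ λ r`. -/
theorem dual_bound_wasserstein_ball
    {X : Type*} [MeasurableSpace X] [MetricSpace X] [PolishSpace X] [BorelSpace X]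
    {n1 : ℕ} (hn1 : 0 < n1) (x : Fin n1 → X) {r : ℝ} (hr : 0 ≤ r)
    (μ : Measure X) [IsProbabilityMeasure μ]
    (hμ : wassDist dist μ (empMeasure x) ≤ ENNReal.ofReal r)
    (lam : ℝ) (hlam : 0 ≤ lam) (u : Fin n1 → ℝ) :
    Integrable
        (fun ξ => Finset.univ.inf' (Finset.univ_nonempty_iff.mpr ⟨⟨0, hn1⟩⟩)
          (fun i => lam * dist ξ (x i) - u i)) μ ∧
    (n1 : ℝ)⁻¹ * (∑ i, u i) +
        ∫ ξ, Finset.univ.inf' (Finset.univ_nonempty_iff.mpr ⟨⟨0, hn1⟩⟩)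
          (fun i => lam * dist ξ (x i) - u i) ∂μ
      ≤ lam * r := by
  set f : X → ℝ := fun ξ => Finset.univ.inf' (Finset.univ_nonempty_iff.mpr ⟨⟨0, hn1⟩⟩)
    (fun i => lam * dist ξ (x i) - u i) with hf_def
  have hf : Continuous f := Continuous.finset_inf'_apply _ fun i _ => by fun_prop
  have hK : ∀ a b, f a ≤ f b + lam * dist a b := inf'_mul_dist_sub_le _ x u hlam
  obtain ⟨hint, hmean⟩ := integrable_and_integral_empMeasure hn1 x hf.stronglyMeasurable
  have hu : (n1 : ℝ)⁻¹ * (∑ i, u i) + ∫ ξ, f ξ ∂(empMeasure x) ≤ 0 := by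
    rw [hmean, ← mul_add, ← Finset.sum_add_distrib]
    refine mul_nonpos_of_nonneg_of_nonpos (by positivity) (Finset.sum_nonpos fun i _ => ?_)
    have h : f (x i) ≤ lam * dist (x i) (x i) - u i :=
      Finset.inf'_le (fun j => lam * dist (x i) (x j) - u j) (Finset.mem_univ i)
    rw [dist_self] at h
    linarith
  have key : ∀ ε > 0, Integrable f μ ∧
      ∫ ξ, f ξ ∂μ ≤ ∫ ξ, f ξ ∂(empMeasure x) + lam * (r + ε) := by
    intro ε hε
    have hlt : wassDist dist μ (empMeasure x) < ENNReal.ofReal (r + ε) :=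
      hμ.trans_lt ((ENNReal.ofReal_lt_ofReal_iff (by linarith)).2 (by linarith))
    simp only [wassDist, iInf_lt_iff] at hlt
    obtain ⟨Γ, hP, hQ, hcost⟩ := hlt
    obtain ⟨hi, hle⟩ := integrable_and_integral_le_of_coupling hf hK hP hQ hcost.ne_top hint
    refine ⟨hi, hle.trans ?_⟩
    gcongr
    exact ENNReal.toReal_le_of_le_ofReal (by linarith) hcost.le
  refine ⟨(key 1 one_pos).1, ?_⟩
  have hlim : Filter.Tendsto (fun ε : ℝ => lam * (r + ε)) (nhdsWithin 0 (Set.Ioi 0))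
      (nhds (lam * r)) := by
    have h : Continuous fun ε : ℝ => lam * (r + ε) := by fun_prop
    simpa using (h.tendsto 0).mono_left nhdsWithin_le_nhds
  refine ge_of_tendsto hlim ?_
  filter_upwards [self_mem_nhdsWithin] with ε hε
  linarith [(key ε hε).2]
end
end

section
/- The following Lagrangian weak-duality lower bound holds: the infimum of KL(ν‖μ) over probability measures μ with W(μ,μ0) ≤ r1 and ν with W(ν,ν0) ≤ r2 is greater than or equal to the supremum, over λ1 ≥ 0, λ2 ≥ 0, u1 ∈ ℝ^{n1}, u2 ∈ ℝ^{n2}, of the quantity −λ1·r1 − λ2·r2 + (1/n1) Σ_{i=1}^{n1} u1^i + (1/n2) Σ_{j=1}^{n2} u2^j + inf over all probability measures μ, ν on X of [ KL(ν‖μ) + ∫_X min_{1≤i≤n1}(λ1·c(ξ,x_i) − u1^i) dμ(ξ) + ∫_X min_{1≤j≤n2}(λ2·c(ξ,y_j) − u2^j) dν(ξ) ], with all quantities valued in the extended reals (the integrands are bounded below, so the integrals are well defined). -/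
open MeasureTheory Real ENNReal

noncomputable section

open Classical in
/-- Integral of a bounded-below function, valued in `(-∞, +∞]`: the Bochner integral when `f` is
`μ`-integrable, and `+∞` otherwise (for a function bounded below the negative part is always
integrable against a finite measure, so non-integrability means the integral diverges to `+∞`). -/
def lowIntegral {X : Type*} [MeasurableSpace X] (f : X → ℝ) (μ : Measure X) : EReal :=
  if Integrable f μ then ((∫ a, f a ∂μ : ℝ) : EReal) else ⊤

theorem integrable_empMeasure {X : Type*} [MeasurableSpace X] [MeasurableSingletonClass X]
    {n : ℕ} (hn : 0 < n) (x : Fin n → X) (f : X → ℝ) : Integrable f (empMeasure x) := by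
  refine Integrable.smul_measure ?_ (by simp [hn.ne'])
  exact integrable_finsetSum_measure.2 fun i _ => integrable_dirac (by simp)

theorem integral_empMeasure {X : Type*} [MeasurableSpace X] [MeasurableSingletonClass X]
    {n : ℕ} (x : Fin n → X) (f : X → ℝ) :
    ∫ a, f a ∂(empMeasure x) = (n : ℝ)⁻¹ * ∑ i, f (x i) := by
  rw [empMeasure, integral_smul_measure,
    integral_finsetSum_measure fun i _ => integrable_dirac (by simp)]
  simp

theorem le_add_dist_of_inf' {X : Type*} [MetricSpace X] {n : ℕ}
    (hn : (Finset.univ : Finset (Fin n)).Nonempty) (x : Fin n → X) (u : Fin n → ℝ) {lam : ℝ}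
    (hlam : 0 ≤ lam) (a b : X) :
    Finset.univ.inf' hn (fun i => lam * dist a (x i) - u i)
      ≤ Finset.univ.inf' hn (fun i => lam * dist b (x i) - u i) + lam * dist a b := by
  rw [← sub_le_iff_le_add]
  refine Finset.le_inf' _ _ fun i hi => ?_
  have h1 := Finset.inf'_le (fun i => lam * dist a (x i) - u i) hi
  have h2 := mul_le_mul_of_nonneg_left (dist_triangle a b (x i)) hlam
  linarith

theorem integrable_and_integral_le_of_wassDist_le {X : Type*} [MeasurableSpace X] [MetricSpace X]
    [SecondCountableTopology X] [BorelSpace X] {P Q : Measure X} {f : X → ℝ} {lam r : ℝ}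
    (hlam : 0 ≤ lam) (hr : 0 ≤ r) (hf : Continuous f)
    (hlip : ∀ a b, f a ≤ f b + lam * dist a b) (hQ : Integrable f Q)
    (hW : wassDist dist P Q ≤ ENNReal.ofReal r) :
    Integrable f P ∧ ∫ a, f a ∂P ≤ ∫ a, f a ∂Q + lam * r := by
  have coupling : ∀ s, r < s → Integrable f P ∧ ∫ a, f a ∂P ≤ ∫ a, f a ∂Q + lam * s := by
    intro s hs
    have hlt : wassDist dist P Q < ENNReal.ofReal s :=
      hW.trans_lt ((ENNReal.ofReal_lt_ofReal_iff (hr.trans_lt hs)).2 hs)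
    simp only [wassDist, iInf_lt_iff] at hlt
    obtain ⟨Γ, rfl, rfl, hΓ⟩ := hlt
    have hd_meas : AEStronglyMeasurable (fun p : X × X => dist p.1 p.2) Γ :=
      continuous_dist.aestronglyMeasurable
    have hd_nonneg : 0 ≤ᵐ[Γ] fun p : X × X => dist p.1 p.2 := .of_forall fun _ => dist_nonneg
    have hd : Integrable (fun p : X × X => dist p.1 p.2) Γ :=
      ⟨hd_meas, (hasFiniteIntegral_iff_ofReal hd_nonneg).2 (hΓ.trans ENNReal.ofReal_lt_top)⟩
    have hds : ∫ p, dist p.1 p.2 ∂Γ ≤ s := by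
      rw [integral_eq_lintegral_of_nonneg_ae hd_nonneg hd_meas]
      exact ENNReal.toReal_le_of_le_ofReal (hr.trans hs.le) hΓ.le
    have hsnd : Integrable (fun p : X × X => f p.2) Γ := hQ.comp_measurable measurable_snd
    have hfst : Integrable (fun p : X × X => f p.1) Γ := by
      refine (hsnd.abs.add (hd.const_mul lam)).mono'
        (hf.comp continuous_fst).aestronglyMeasurable (.of_forall fun p => ?_)
      have h1 := hlip p.1 p.2
      have h2 := hlip p.2 p.1
      rw [dist_comm] at h2
      have h3 := neg_abs_le (f p.2)
      have h4 := le_abs_self (f p.2)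
      simp only [Pi.add_apply, Real.norm_eq_abs]
      rw [abs_le]
      constructor <;> linarith
    refine ⟨(integrable_map_measure hf.aestronglyMeasurable measurable_fst.aemeasurable).2 hfst, ?_⟩
    rw [integral_map measurable_fst.aemeasurable hf.aestronglyMeasurable,
      integral_map measurable_snd.aemeasurable hf.aestronglyMeasurable]
    calc ∫ p, f p.1 ∂Γ ≤ ∫ p, (f p.2 + lam * dist p.1 p.2) ∂Γ :=
          integral_mono hfst (hsnd.add (hd.const_mul lam)) fun p => hlip p.1 p.2
      _ = ∫ p, f p.2 ∂Γ + lam * ∫ p, dist p.1 p.2 ∂Γ := by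
          rw [integral_add hsnd (hd.const_mul lam), integral_const_mul]
      _ ≤ _ := by gcongr
  refine ⟨(coupling (r + 1) (by linarith)).1, ?_⟩
  have hlim : Filter.Tendsto (fun s => ∫ a, f a ∂Q + lam * s) (nhdsWithin r (Set.Ioi r))
      (nhds (∫ a, f a ∂Q + lam * r)) :=
    ((by fun_prop : Continuous fun s => ∫ a, f a ∂Q + lam * s).tendsto r).mono_left
      nhdsWithin_le_nhds
  exact ge_of_tendsto hlim (eventually_mem_nhdsWithin.mono fun s hs => (coupling s hs).2)

theorem lowIntegral_inf'_le {X : Type*} [MeasurableSpace X] [MetricSpace X]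
    [SecondCountableTopology X] [BorelSpace X] {n : ℕ} (hn : 0 < n)
    (hne : (Finset.univ : Finset (Fin n)).Nonempty) (x : Fin n → X) (u : Fin n → ℝ)
    {lam r : ℝ} (hlam : 0 ≤ lam) (hr : 0 ≤ r) {P : Measure X}
    (hW : wassDist dist P (empMeasure x) ≤ ENNReal.ofReal r) :
    lowIntegral (fun ξ => Finset.univ.inf' hne (fun i => lam * dist ξ (x i) - u i)) P
      ≤ ((lam * r - (n : ℝ)⁻¹ * ∑ i, u i : ℝ) : EReal) := by
  obtain ⟨hint, hle⟩ := integrable_and_integral_le_of_wassDist_le hlam hr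
    (f := fun ξ => Finset.univ.inf' hne (fun i => lam * dist ξ (x i) - u i))
    (Continuous.finset_inf'_apply hne fun i _ => by fun_prop)
    (le_add_dist_of_inf' hne x u hlam) (integrable_empMeasure hn x _) hW
  rw [lowIntegral, if_pos hint, EReal.coe_le_coe_iff]
  rw [integral_empMeasure] at hle
  have hsum : ∑ i, Finset.univ.inf' hne (fun k => lam * dist (x i) (x k) - u k) ≤ -∑ i, u i := by
    rw [← Finset.sum_neg_distrib]
    refine Finset.sum_le_sum fun i hi => (Finset.inf'_le _ hi).trans ?_
    simp
  have := mul_le_mul_of_nonneg_left hsum (by positivity : 0 ≤ (n : ℝ)⁻¹)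
  linarith

/-- **Lagrangian weak duality.** The infimum of `KL(ν‖μ)` over the Wasserstein balls
`W(μ, μ0) ≤ r1`, `W(ν, ν0) ≤ r2` is at least the supremum over `λ1, λ2 ≥ 0`, `u1 ∈ ℝ^{n1}`,
`u2 ∈ ℝ^{n2}` of
`−λ1 r1 − λ2 r2 + (1/n1) ∑ᵢ u1ⁱ + (1/n2) ∑ⱼ u2ʲ +
  inf_{μ, ν} [ KL(ν‖μ) + ∫ minᵢ (λ1 c(ξ, x_i) − u1ⁱ) dμ + ∫ minⱼ (λ2 c(ξ, y_j) − u2ʲ) dν ]`,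
the inner infimum being over all pairs of probability measures on `X`. -/
theorem lagrangian_weak_duality
    {X : Type*} [MeasurableSpace X] [MetricSpace X] [PolishSpace X] [BorelSpace X]
    {n1 n2 : ℕ} (hn1 : 0 < n1) (hn2 : 0 < n2)
    (x : Fin n1 → X) (y : Fin n2 → X) {r1 r2 : ℝ} (hr1 : 0 ≤ r1) (hr2 : 0 ≤ r2) :
    sSup {e : EReal | ∃ (lam1 lam2 : ℝ) (u1 : Fin n1 → ℝ) (u2 : Fin n2 → ℝ),
        0 ≤ lam1 ∧ 0 ≤ lam2 ∧
        e = ((-lam1 * r1 - lam2 * r2 + (n1 : ℝ)⁻¹ * (∑ i, u1 i)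
                + (n2 : ℝ)⁻¹ * (∑ j, u2 j) : ℝ) : EReal)
            + sInf {d : EReal | ∃ μ ν : Measure X,
                IsProbabilityMeasure μ ∧ IsProbabilityMeasure ν ∧
                d = KLdiv ν μ
                    + lowIntegral (fun ξ => Finset.univ.inf'
                        (Finset.univ_nonempty_iff.mpr ⟨⟨0, hn1⟩⟩)
                        (fun i => lam1 * dist ξ (x i) - u1 i)) μ
                    + lowIntegral (fun ξ => Finset.univ.inf'
                        (Finset.univ_nonempty_iff.mpr ⟨⟨0, hn2⟩⟩)
                        (fun j => lam2 * dist ξ (y j) - u2 j)) ν}}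
      ≤ sInf (klBallValues x y r1 r2) := by
  refine sSup_le ?_
  rintro _ ⟨lam1, lam2, u1, u2, hl1, hl2, rfl⟩
  refine le_sInf ?_
  rintro _ ⟨μ, ν, hμ, hν, hW1, hW2, rfl⟩
  have h1 := lowIntegral_inf'_le hn1 (Finset.univ_nonempty_iff.mpr ⟨⟨0, hn1⟩⟩) x u1 hl1 hr1 hW1
  have h2 := lowIntegral_inf'_le hn2 (Finset.univ_nonempty_iff.mpr ⟨⟨0, hn2⟩⟩) y u2 hl2 hr2 hW2
  refine le_trans (add_le_add_right (le_trans (sInf_le ?_)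
    (add_le_add (add_le_add_right h1 (KLdiv ν μ)) h2)) _) (le_of_eq ?_)
  · exact ⟨μ, ν, hμ, hν, rfl⟩
  rw [add_assoc (KLdiv ν μ), add_left_comm, ← EReal.coe_add, ← EReal.coe_add]
  convert add_zero (KLdiv ν μ)
  rw [EReal.coe_eq_zero]
  ring
end
end

section
/- Fix λ1, λ2 ≥ 0, u1 ∈ ℝ^{n1}, u2 ∈ ℝ^{n2}, and define f(ξ) = min_{1≤i≤n1}(λ1·c(ξ, x_i) − u1^i) and g(ξ) = min_{1≤j≤n2}(λ2·c(ξ, y_j) − u2^j). For any probability measures μ, ν on X with ν absolutely continuous with respect to μ, there exists a Borel measurable map T : X → X taking values in the finite set {z_1,…,z_n} = {x_1,…,x_{n1},y_1,…,y_{n2}} such that the pushforward measures μ' = T_#μ and ν' = T_#ν satisfy KL(ν'‖μ') + ∫ f dμ' + ∫ g dν' ≤ KL(ν‖μ) + ∫ f dμ + ∫ g dν, where all quantities are valued in the extended reals (f and g are bounded below, so their integrals are well defined in (−∞,+∞]). -/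
open MeasureTheory Real ENNReal

noncomputable section

open InformationTheory

lemma KLdiv_eq_coe_klDiv {X : Type*} [MeasurableSpace X] (ν μ : Measure X)
    [IsProbabilityMeasure ν] [IsProbabilityMeasure μ] :
    KLdiv ν μ = ((klDiv ν μ : ℝ≥0∞) : EReal) := by
  unfold KLdiv
  split_ifs with h
  · rw [← ENNReal.ofReal_toReal (klDiv_ne_top h.1 h.2),
      toReal_klDiv_of_measure_eq h.1 (by simp), EReal.coe_ennreal_ofReal, max_eq_left]
    rw [← toReal_klDiv_of_measure_eq h.1 (by simp)]
    exact ENNReal.toReal_nonneg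
  · have : klDiv ν μ = ∞ := by
      rw [klDiv_eq_top_iff]
      tauto
    simp [this]

/-- Data processing inequality for `KLdiv`. -/
lemma KLdiv_map_le {X Y : Type*} [MeasurableSpace X] [MeasurableSpace Y] (ν μ : Measure X)
    [IsProbabilityMeasure ν] [IsProbabilityMeasure μ] {T : X → Y} (hT : Measurable T) :
    KLdiv (ν.map T) (μ.map T) ≤ KLdiv ν μ := by
  have := Measure.isProbabilityMeasure_map (μ := μ) hT.aemeasurable
  have := Measure.isProbabilityMeasure_map (μ := ν) hT.aemeasurable
  rw [KLdiv_eq_coe_klDiv, KLdiv_eq_coe_klDiv, EReal.coe_ennreal_le_coe_ennreal_iff]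
  exact klDiv_map_le ν μ hT

lemma lowIntegral_ne_bot {X : Type*} [MeasurableSpace X] (f : X → ℝ) (μ : Measure X) :
    lowIntegral f μ ≠ ⊥ := by
  unfold lowIntegral
  split_ifs <;> simp

lemma measurable_finset_inf' {X ι : Type*} [MeasurableSpace X] {s : Finset ι} (hs : s.Nonempty)
    {h : ι → X → ℝ} (hm : ∀ i, Measurable (h i)) :
    Measurable fun ξ => s.inf' hs (fun i => h i ξ) := by
  have := Finset.inf'_induction hs h (p := Measurable) (fun _ hf _ hg => hf.inf hg)
    fun i _ => hm i
  convert this with ξ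
  exact (Finset.inf'_apply hs h ξ).symm

/-- A finite family of measurable real functions admits a measurable selection of minimizers. -/
lemma exists_measurable_argmin {X ι : Type*} [MeasurableSpace X] [MeasurableSpace ι]
    (h : ι → X → ℝ) (hm : ∀ i, Measurable (h i)) (s : Finset ι) (hs : s.Nonempty) :
    ∃ k : X → ι, Measurable k ∧ ∀ ξ, h (k ξ) ξ = s.inf' hs (fun i => h i ξ) := by
  induction hs using Finset.Nonempty.cons_induction with
  | singleton a => exact ⟨fun _ => a, measurable_const, fun ξ => by simp⟩
  | cons a s ha hs ih =>
    obtain ⟨k, hk, hmin⟩ := ih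
    refine ⟨fun ξ => if h a ξ ≤ s.inf' hs (fun i => h i ξ) then a else k ξ,
      Measurable.ite (measurableSet_le (hm a) (measurable_finset_inf' hs hm)) measurable_const hk,
      fun ξ => ?_⟩
    rw [Finset.inf'_cons hs]
    dsimp only
    split_ifs with hle
    · exact (inf_eq_left.mpr hle).symm
    · rw [hmin, inf_eq_right.mpr (not_le.mp hle).le]

lemma integrable_map_of_finite_range {X Y : Type*} [MeasurableSpace X] [MeasurableSpace Y]
    (μ : Measure X) [IsFiniteMeasure μ] {T : X → Y} (hT : Measurable T) {s : Set Y}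
    (hs : s.Finite) (hTs : ∀ ξ, T ξ ∈ s) {f : Y → ℝ} (hf : Measurable f) :
    Integrable f (μ.map T) := by
  rw [integrable_map_measure hf.aestronglyMeasurable hT.aemeasurable]
  obtain ⟨C, hC⟩ := (hs.image fun z => ‖f z‖).bddAbove
  exact Integrable.of_bound (hf.comp hT).aestronglyMeasurable C
    (.of_forall fun ξ => hC ⟨T ξ, hTs ξ, rfl⟩)

/-- If `T` has finite range and decreases `f + (dν/dμ) g` pointwise, then pushing forward along `T`
decreases `∫ f dμ + ∫ g dν`. -/
lemma lowIntegral_map_add_le {X : Type*} [MeasurableSpace X] (μ ν : Measure X)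
    [IsFiniteMeasure μ] [IsFiniteMeasure ν] (hac : ν ≪ μ) {T : X → X} (hT : Measurable T)
    {s : Set X} (hs : s.Finite) (hTs : ∀ ξ, T ξ ∈ s) {f g : X → ℝ} (hf : Measurable f)
    (hg : Measurable g)
    (hle : ∀ ξ, f (T ξ) + (ν.rnDeriv μ ξ).toReal * g (T ξ)
      ≤ f ξ + (ν.rnDeriv μ ξ).toReal * g ξ) :
    lowIntegral f (μ.map T) + lowIntegral g (ν.map T) ≤ lowIntegral f μ + lowIntegral g ν := by
  by_cases hfi : Integrable f μ
  swap
  · rw [show lowIntegral f μ = ⊤ from if_neg hfi, EReal.top_add_of_ne_bot (lowIntegral_ne_bot _ _)]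
    exact le_top
  by_cases hgi : Integrable g ν
  swap
  · rw [show lowIntegral g ν = ⊤ from if_neg hgi, EReal.add_top_of_ne_bot (lowIntegral_ne_bot _ _)]
    exact le_top
  have hfT := integrable_map_of_finite_range μ hT hs hTs hf
  have hgT := integrable_map_of_finite_range ν hT hs hTs hg
  rw [lowIntegral, lowIntegral, lowIntegral, lowIntegral, if_pos hfi, if_pos hgi, if_pos hfT,
    if_pos hgT, ← EReal.coe_add, ← EReal.coe_add, EReal.coe_le_coe_iff,
    integral_map hT.aemeasurable hf.aestronglyMeasurable,
    integral_map hT.aemeasurable hg.aestronglyMeasurable,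
    ← integral_rnDeriv_smul hac, ← integral_rnDeriv_smul hac]
  have hfT' := hfT.comp_measurable hT
  have hgT' := (integrable_rnDeriv_smul_iff hac).mpr (hgT.comp_measurable hT)
  have hg' := (integrable_rnDeriv_smul_iff hac).mpr hgi
  rw [← integral_add hfi hg']
  exact (integral_add hfT' hgT').symm.trans_le (integral_mono (hfT'.add hgT') (hfi.add hg') hle)

lemma measurable_inf'_dist {X : Type*} [MeasurableSpace X] [MetricSpace X] [BorelSpace X]
    {ι : Type*} (s : Finset ι) (hs : s.Nonempty) (x : ι → X) (lam : ℝ) (u : ι → ℝ) :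
    Measurable fun ξ => s.inf' hs (fun i => lam * dist ξ (x i) - u i) :=
  measurable_finset_inf' hs fun _ => Continuous.measurable (by fun_prop)

/-- The minimum of finitely many functions `lam * dist · (x i) - u i` is `lam`-Lipschitz. -/
lemma inf'_dist_le_add {X : Type*} [MetricSpace X] {ι : Type*} (s : Finset ι) (hs : s.Nonempty)
    (x : ι → X) {lam : ℝ} (hlam : 0 ≤ lam) (u : ι → ℝ) (ξ ζ : X) :
    s.inf' hs (fun i => lam * dist ζ (x i) - u i)
      ≤ s.inf' hs (fun i => lam * dist ξ (x i) - u i) + lam * dist ξ ζ := by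
  rw [← sub_le_iff_le_add]
  refine Finset.le_inf' hs _ fun i hi => ?_
  have h1 := Finset.inf'_le (fun i => lam * dist ζ (x i) - u i) hi
  have h2 := mul_le_mul_of_nonneg_left (dist_triangle_left ζ (x i) ξ) hlam
  linarith

/-- Moving `ξ` to a minimizing point `x i` lowers the minimum by at least `lam * dist ξ (x i)`. -/
lemma inf'_dist_add_le {X : Type*} [MetricSpace X] {ι : Type*} (s : Finset ι) (hs : s.Nonempty)
    (x : ι → X) (lam : ℝ) (u : ι → ℝ) (ξ : X) {i : ι} (hi : i ∈ s)
    (hmin : lam * dist ξ (x i) - u i = s.inf' hs (fun i => lam * dist ξ (x i) - u i)) :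
    s.inf' hs (fun k => lam * dist (x i) (x k) - u k) + lam * dist ξ (x i)
      ≤ s.inf' hs (fun i => lam * dist ξ (x i) - u i) := by
  have h := Finset.inf'_le (fun k => lam * dist (x i) (x k) - u k) hi
  simp only [dist_self, mul_zero] at h
  linarith

/-- **Reduction to the empirical support.** With
`f ξ = minᵢ (λ1 c(ξ, x_i) − u1ⁱ)` and `g ξ = minⱼ (λ2 c(ξ, y_j) − u2ʲ)`, for any probability
measures `μ, ν` with `ν ≪ μ` there is a Borel map `T : X → X` taking values in the finite set
`{x_1,…,x_{n1}, y_1,…,y_{n2}}` whose pushforwards `μ' = T_#μ`, `ν' = T_#ν` satisfy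
`KL(ν'‖μ') + ∫ f dμ' + ∫ g dν' ≤ KL(ν‖μ) + ∫ f dμ + ∫ g dν`. -/
theorem pushforward_to_empirical_support
    {X : Type*} [MeasurableSpace X] [MetricSpace X] [PolishSpace X] [BorelSpace X]
    {n1 n2 : ℕ} (hn1 : 0 < n1) (hn2 : 0 < n2)
    (x : Fin n1 → X) (y : Fin n2 → X)
    (lam1 lam2 : ℝ) (hlam1 : 0 ≤ lam1) (hlam2 : 0 ≤ lam2)
    (u1 : Fin n1 → ℝ) (u2 : Fin n2 → ℝ)
    (μ ν : Measure X) [IsProbabilityMeasure μ] [IsProbabilityMeasure ν] (hac : ν ≪ μ) :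
    ∃ T : X → X, Measurable T ∧ (∀ ξ, T ξ ∈ Set.range (Fin.append x y)) ∧
      KLdiv (ν.map T) (μ.map T)
          + lowIntegral (fun ξ => Finset.univ.inf' (Finset.univ_nonempty_iff.mpr ⟨⟨0, hn1⟩⟩)
              (fun i => lam1 * dist ξ (x i) - u1 i)) (μ.map T)
          + lowIntegral (fun ξ => Finset.univ.inf' (Finset.univ_nonempty_iff.mpr ⟨⟨0, hn2⟩⟩)
              (fun j => lam2 * dist ξ (y j) - u2 j)) (ν.map T)
        ≤ KLdiv ν μ
          + lowIntegral (fun ξ => Finset.univ.inf' (Finset.univ_nonempty_iff.mpr ⟨⟨0, hn1⟩⟩)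
              (fun i => lam1 * dist ξ (x i) - u1 i)) μ
          + lowIntegral (fun ξ => Finset.univ.inf' (Finset.univ_nonempty_iff.mpr ⟨⟨0, hn2⟩⟩)
              (fun j => lam2 * dist ξ (y j) - u2 j)) ν := by
  have hne1 : (Finset.univ : Finset (Fin n1)).Nonempty := Finset.univ_nonempty_iff.mpr ⟨⟨0, hn1⟩⟩
  have hne2 : (Finset.univ : Finset (Fin n2)).Nonempty := Finset.univ_nonempty_iff.mpr ⟨⟨0, hn2⟩⟩
  obtain ⟨i, hi, himin⟩ := exists_measurable_argmin
    (fun i (ξ : X) => lam1 * dist ξ (x i) - u1 i)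
    (fun i => Continuous.measurable (by fun_prop)) Finset.univ hne1
  obtain ⟨j, hj, hjmin⟩ := exists_measurable_argmin
    (fun j (ξ : X) => lam2 * dist ξ (y j) - u2 j)
    (fun j => Continuous.measurable (by fun_prop)) Finset.univ hne2
  set r : X → ℝ := fun ξ => (ν.rnDeriv μ ξ).toReal
  have hrm : Measurable r := (Measure.measurable_rnDeriv ν μ).ennreal_toReal
  set T : X → X := fun ξ => if r ξ * lam2 ≤ lam1 then x (i ξ) else y (j ξ) with hTdef
  have hT : Measurable T :=
    Measurable.ite (measurableSet_le (hrm.mul_const _) measurable_const)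
      ((measurable_of_finite x).comp hi) ((measurable_of_finite y).comp hj)
  have hTs : ∀ ξ, T ξ ∈ Set.range (Fin.append x y) := by
    intro ξ
    simp only [hTdef]
    split_ifs
    · exact ⟨Fin.castAdd n2 (i ξ), Fin.append_left x y _⟩
    · exact ⟨Fin.natAdd n1 (j ξ), Fin.append_right x y _⟩
  refine ⟨T, hT, hTs, ?_⟩
  rw [add_assoc, add_assoc]
  refine add_le_add (KLdiv_map_le ν μ hT) (lowIntegral_map_add_le μ ν hac hT (Set.finite_range _)
    hTs (measurable_inf'_dist _ hne1 x lam1 u1) (measurable_inf'_dist _ hne2 y lam2 u2)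
    fun ξ => ?_)
  have hr0 : 0 ≤ r ξ := ENNReal.toReal_nonneg
  change _ + r ξ * _ ≤ _ + r ξ * _
  by_cases hcase : r ξ * lam2 ≤ lam1
  · rw [show T ξ = x (i ξ) from if_pos hcase]
    have h1 := inf'_dist_add_le _ hne1 x lam1 u1 ξ (Finset.mem_univ (i ξ)) (himin ξ)
    have h2 := mul_le_mul_of_nonneg_left
      (inf'_dist_le_add _ hne2 y hlam2 u2 ξ (x (i ξ))) hr0
    have h3 := mul_le_mul_of_nonneg_right hcase (dist_nonneg (x := ξ) (y := x (i ξ)))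
    linarith
  · rw [show T ξ = y (j ξ) from if_neg hcase]
    have h1 := mul_le_mul_of_nonneg_left
      (inf'_dist_add_le _ hne2 y lam2 u2 ξ (Finset.mem_univ (j ξ)) (hjmin ξ)) hr0
    have h2 := inf'_dist_le_add _ hne1 x hlam1 u1 ξ (y (j ξ))
    have h3 := mul_le_mul_of_nonneg_right (not_le.mp hcase).le (dist_nonneg (x := ξ) (y := y (j ξ)))
    linarith
end
end

section
/- Pythagorean inequality for KL projections onto convex sets (this is the inequality underlying condition (7) of weak stochastic boundedness for KL-minimizing least favorable distributions): let μ̃ be a probability measure on a measurable space X and let C be a convex set of probability measures on X. If ν̃ ∈ C satisfies KL(ν̃‖μ̃) < ∞ and KL(ν̃‖μ̃) ≤ KL(ν‖μ̃) for all ν ∈ C, then for every ν ∈ C: KL(ν̃‖μ̃) + KL(ν‖ν̃) ≤ KL(ν‖μ̃). -/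
open MeasureTheory Real ENNReal

noncomputable section

/-- The pointwise Bregman divergence `p log (p / m) - p + m` of `x ↦ x log x` is nonnegative. -/
lemma mul_log_sub_mul_log_sub_add_nonneg {p m : ℝ} (hp : 0 ≤ p) (hm : 0 ≤ m)
    (hpm : m = 0 → p = 0) : 0 ≤ p * Real.log p - p * Real.log m - p + m := by
  rcases hp.eq_or_lt with rfl | hp
  · simpa using hm
  have hm : 0 < m := hm.lt_of_ne fun h ↦ hp.ne' (hpm h.symm)
  have h := Real.log_le_sub_one_of_pos (div_pos hm hp)
  rw [Real.log_div hm.ne' hp.ne'] at h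
  have h' := mul_le_mul_of_nonneg_left h hp.le
  have : p * (m / p - 1) = m - p := by field_simp
  linarith

lemma neg_one_le_mul_log {x : ℝ} (hx : 0 ≤ x) : -1 ≤ x * Real.log x := by
  have := mul_log_sub_mul_log_sub_add_nonneg (m := 1) hx zero_le_one (by simp)
  simp only [Real.log_one, mul_zero] at this
  linarith

/-- The compensation identity, with one of its nonnegative terms dropped. -/
lemma mul_bregman_le {p q t : ℝ} (hp : 0 ≤ p) (hq : 0 ≤ q) (ht : 0 < t) (ht1 : t < 1) :
    t * (p * Real.log p - p * Real.log (t * p + (1 - t) * q) - p + (t * p + (1 - t) * q)) ≤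
      t * (p * Real.log p) + (1 - t) * (q * log q) -
        (t * p + (1 - t) * q) * Real.log (t * p + (1 - t) * q) := by
  have ht' : 0 < 1 - t := sub_pos.2 ht1
  have h := mul_log_sub_mul_log_sub_add_nonneg (p := q) (m := t * p + (1 - t) * q) hq
    (by positivity) (fun h ↦ by nlinarith [mul_nonneg ht.le hp, mul_nonneg ht'.le hq])
  nlinarith [mul_nonneg ht'.le h]

lemma bregman_mix_nonneg {p q t : ℝ} (hp : 0 ≤ p) (hq : 0 ≤ q) (ht : 0 < t) (ht1 : t < 1) :
    0 ≤ p * Real.log p - p * Real.log (t * p + (1 - t) * q) - p + (t * p + (1 - t) * q) := by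
  have ht' : 0 < 1 - t := sub_pos.2 ht1
  exact mul_log_sub_mul_log_sub_add_nonneg hp (by positivity)
    (fun h ↦ by nlinarith [mul_nonneg ht.le hp, mul_nonneg ht'.le hq])

lemma integrable_mul_log_mix {X : Type*} [MeasurableSpace X] {μ : Measure X} [IsFiniteMeasure μ]
    {p q : X → ℝ} (hp : Measurable p) (hq : Measurable q) (hp0 : ∀ x, 0 ≤ p x)
    (hq0 : ∀ x, 0 ≤ q x) (hpi : Integrable (fun x ↦ p x * Real.log (p x)) μ)
    (hqi : Integrable (fun x ↦ q x * Real.log (q x)) μ) {t : ℝ} (ht : 0 < t) (ht1 : t < 1) :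
    Integrable (fun x ↦ (t * p x + (1 - t) * q x) * Real.log (t * p x + (1 - t) * q x)) μ := by
  have ht' : 0 < 1 - t := sub_pos.2 ht1
  refine integrable_of_le_of_le (f := fun x ↦ (t * p x + (1 - t) * q x) *
      Real.log (t * p x + (1 - t) * q x)) (g₁ := fun _ ↦ (-1 : ℝ))
    (g₂ := fun x ↦ t * (p x * Real.log (p x)) + (1 - t) * (q x * Real.log (q x))) ?_
    (ae_of_all _ fun x ↦ ?_) (ae_of_all _ fun x ↦ ?_) (integrable_const _)
    ((hpi.const_mul t).add (hqi.const_mul _))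
  · exact Measurable.aestronglyMeasurable (by fun_prop)
  · have := hp0 x
    have := hq0 x
    exact neg_one_le_mul_log (by positivity)
  · have h1 := mul_bregman_le (hp0 x) (hq0 x) ht ht1
    have h2 := mul_nonneg ht.le (bregman_mix_nonneg (hp0 x) (hq0 x) ht ht1)
    exact sub_nonneg.1 (h2.trans h1)

/-- If `q` minimizes the entropy functional along the segment from `q` to `p`, then the divergence
from `p` to each interior point of the segment is bounded by the entropy gap. -/
lemma lintegral_bregman_mix_le {X : Type*} [MeasurableSpace X] {μ : Measure X} [IsFiniteMeasure μ]
    {p q : X → ℝ} (hp : Measurable p) (hq : Measurable q) (hp0 : ∀ x, 0 ≤ p x)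
    (hq0 : ∀ x, 0 ≤ q x) (hpi : Integrable (fun x ↦ p x * Real.log (p x)) μ)
    (hqi : Integrable (fun x ↦ q x * Real.log (q x)) μ) {t : ℝ} (ht : 0 < t) (ht1 : t < 1)
    (hmin : ∫ x, q x * Real.log (q x) ∂μ ≤
      ∫ x, (t * p x + (1 - t) * q x) * Real.log (t * p x + (1 - t) * q x) ∂μ) :
    ∫⁻ x, ENNReal.ofReal (p x * Real.log (p x) - p x * Real.log (t * p x + (1 - t) * q x) - p x
        + (t * p x + (1 - t) * q x)) ∂μ ≤
      ENNReal.ofReal (∫ x, p x * Real.log (p x) ∂μ - ∫ x, q x * Real.log (q x) ∂μ) := by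
  have hmi := integrable_mul_log_mix hp hq hp0 hq0 hpi hqi ht ht1
  set m : X → ℝ := fun x ↦ t * p x + (1 - t) * q x
  have hI : Integrable (fun x ↦ t⁻¹ * (t * (p x * Real.log (p x)) + (1 - t) * (q x * Real.log (q x))
      - m x * Real.log (m x))) μ :=
    (((hpi.const_mul t).add (hqi.const_mul _)).sub hmi).const_mul _
  have hle : ∀ x, p x * Real.log (p x) - p x * Real.log (m x) - p x + m x ≤
      t⁻¹ * (t * (p x * Real.log (p x)) + (1 - t) * (q x * Real.log (q x)) - m x * Real.log (m x)) := fun x ↦ by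
    rw [le_inv_mul_iff₀ ht]
    exact mul_bregman_le (hp0 x) (hq0 x) ht ht1
  calc _ ≤ ∫⁻ x, ENNReal.ofReal (t⁻¹ * (t * (p x * Real.log (p x)) + (1 - t) * (q x * Real.log (q x))
          - m x * Real.log (m x))) ∂μ := lintegral_mono fun x ↦ ENNReal.ofReal_le_ofReal (hle x)
    _ = ENNReal.ofReal (∫ x, t⁻¹ * (t * (p x * Real.log (p x)) + (1 - t) * (q x * Real.log (q x))
          - m x * Real.log (m x)) ∂μ) := (ofReal_integral_eq_lintegral_ofReal hI
            (ae_of_all _ fun x ↦ (bregman_mix_nonneg (hp0 x) (hq0 x) ht ht1).trans (hle x))).symm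
    _ ≤ _ := by
      refine ENNReal.ofReal_le_ofReal ?_
      rw [integral_const_mul, integral_sub (by fun_prop) hmi,
        integral_add (hpi.const_mul t) (hqi.const_mul _), integral_const_mul, integral_const_mul,
        inv_mul_le_iff₀ ht]
      linarith

open Filter Topology in
/-- Density form of the Pythagorean inequality. -/
lemma pythagorean_of_le_mix {X : Type*} [MeasurableSpace X] {μ : Measure X} [IsFiniteMeasure μ]
    {p q : X → ℝ} (hp : Measurable p) (hq : Measurable q) (hp0 : ∀ x, 0 ≤ p x)
    (hq0 : ∀ x, 0 ≤ q x) (hp1 : Integrable p μ) (hq1 : Integrable q μ)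
    (hpq : ∫ x, p x ∂μ = ∫ x, q x ∂μ) (hpi : Integrable (fun x ↦ p x * Real.log (p x)) μ)
    (hqi : Integrable (fun x ↦ q x * Real.log (q x)) μ)
    (hmin : ∀ t : ℝ, 0 < t → t < 1 → ∫ x, q x * Real.log (q x) ∂μ ≤
      ∫ x, (t * p x + (1 - t) * q x) * Real.log (t * p x + (1 - t) * q x) ∂μ) :
    (∀ᵐ x ∂μ, q x = 0 → p x = 0) ∧ Integrable (fun x ↦ p x * (Real.log (p x) - Real.log (q x))) μ ∧
      ∫ x, q x * Real.log (q x) ∂μ + ∫ x, p x * (Real.log (p x) - Real.log (q x)) ∂μ ≤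
        ∫ x, p x * Real.log (p x) ∂μ := by
  set K := ∫ x, p x * Real.log (p x) ∂μ - ∫ x, q x * Real.log (q x) ∂μ
  let t : ℕ → ℝ := fun n ↦ 1 / ((n + 1 : ℕ) + 1 : ℝ)
  have ht : ∀ n, 0 < t n := fun n ↦ by positivity
  have ht1 : ∀ n, t n < 1 := fun n ↦ by
    rw [div_lt_one (by positivity)]
    push_cast
    linarith [Nat.cast_nonneg (α := ℝ) n]
  have htlim : Tendsto t atTop (𝓝 0) :=
    (tendsto_add_atTop_iff_nat 1).2 (tendsto_one_div_add_atTop_nhds_zero_nat (𝕜 := ℝ))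
  let h : ℕ → X → ℝ := fun n x ↦ p x * Real.log (p x) - p x * Real.log (t n * p x + (1 - t n) * q x) - p x
    + (t n * p x + (1 - t n) * q x)
  have hfatou : ∫⁻ x, liminf (fun n ↦ ENNReal.ofReal (h n x)) atTop ∂μ ≤ ENNReal.ofReal K := by
    refine (lintegral_liminf_le fun n ↦ by fun_prop).trans ?_
    refine (liminf_le_liminf (v := fun _ ↦ ENNReal.ofReal K) (Eventually.of_forall fun n ↦
      lintegral_bregman_mix_le hp hq hp0 hq0 hpi hqi (ht n) (ht1 n)
        (hmin _ (ht n) (ht1 n)))).trans (by simp)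
  have hfin : ∀ᵐ x ∂μ, liminf (fun n ↦ ENNReal.ofReal (h n x)) atTop < ⊤ :=
    ae_lt_top (.liminf fun n ↦ by fun_prop) (hfatou.trans_lt ENNReal.ofReal_lt_top).ne
  have hac : ∀ᵐ x ∂μ, q x = 0 → p x = 0 := by
    filter_upwards [hfin] with x hx hqx
    by_contra hpx
    have hpx : 0 < p x := (hp0 x).lt_of_ne' hpx
    refine hx.ne (Tendsto.liminf_eq (ENNReal.tendsto_ofReal_atTop.comp ?_))
    have heq : (fun n ↦ h n x) = fun n ↦ p x * -Real.log (t n) + (-p x + t n * p x) := by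
      ext n
      simp only [h, hqx, mul_zero, add_zero, Real.log_mul (ht n).ne' hpx.ne']
      ring
    rw [heq]
    refine Tendsto.atTop_add (C := -p x + 0 * p x) (Tendsto.const_mul_atTop hpx ?_)
      (tendsto_const_nhds.add (htlim.mul_const _))
    exact tendsto_neg_atBot_atTop.comp (Real.tendsto_log_nhdsGT_zero.comp
      (tendsto_nhdsWithin_iff.2 ⟨htlim, Eventually.of_forall ht⟩))
  have hlim : ∀ᵐ x ∂μ, liminf (fun n ↦ ENNReal.ofReal (h n x)) atTop =
      ENNReal.ofReal (p x * Real.log (p x) - p x * Real.log (q x) - p x + q x) := by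
    filter_upwards [hac] with x hx
    refine Tendsto.liminf_eq (ENNReal.tendsto_ofReal ?_)
    have hm : Tendsto (fun n ↦ t n * p x + (1 - t n) * q x) atTop (𝓝 (q x)) := by
      simpa using (htlim.mul_const (p x)).add ((htlim.const_sub 1).mul_const (q x))
    by_cases hqx : q x = 0
    · simp [h, hqx, hx hqx]
    · exact ((tendsto_const_nhds.sub ((hm.log hqx).const_mul _)).sub_const _).add hm
  rw [lintegral_congr_ae hlim] at hfatou
  have hnn : 0 ≤ᵐ[μ] fun x ↦ p x * Real.log (p x) - p x * Real.log (q x) - p x + q x := by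
    filter_upwards [hac] with x hx
    exact mul_log_sub_mul_log_sub_add_nonneg (hp0 x) (hq0 x) hx
  have hint : Integrable (fun x ↦ p x * Real.log (p x) - p x * Real.log (q x) - p x + q x) μ :=
    (lintegral_ofReal_ne_top_iff_integrable (Measurable.aestronglyMeasurable (by fun_prop))
      hnn).1 (hfatou.trans_lt ENNReal.ofReal_lt_top).ne
  have hK0 : 0 ≤ K := by
    have hb := hmin (1 / 2) (by norm_num) (by norm_num)
    have hc := integral_mono (μ := μ) (integrable_mul_log_mix hp hq hp0 hq0 hpi hqi
      (t := 1 / 2) (by norm_num) (by norm_num))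
      ((hpi.const_mul (1 / 2)).add (hqi.const_mul (1 - 1 / 2))) fun x ↦ by
        have h1 := mul_bregman_le (hp0 x) (hq0 x) (t := 1 / 2) (by norm_num) (by norm_num)
        have h2 := bregman_mix_nonneg (hp0 x) (hq0 x) (t := 1 / 2) (by norm_num) (by norm_num)
        exact sub_nonneg.1 ((mul_nonneg (by norm_num) h2).trans h1)
    have hd := integral_add (hpi.const_mul (1 / 2)) (hqi.const_mul (1 - 1 / 2))
    simp only [Pi.add_apply] at hc
    rw [hd, integral_const_mul, integral_const_mul] at hc
    linarith
  have hle : ∫ x, (p x * Real.log (p x) - p x * Real.log (q x) - p x + q x) ∂μ ≤ K := by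
    rwa [← ofReal_integral_eq_lintegral_ofReal hint hnn, ENNReal.ofReal_le_ofReal_iff hK0]
      at hfatou
  have heq : (fun x ↦ p x * (Real.log (p x) - Real.log (q x))) =
      fun x ↦ (p x * Real.log (p x) - p x * Real.log (q x) - p x + q x) + (p x - q x) := by
    ext x
    ring
  refine ⟨hac, ?_, ?_⟩
  · rw [heq]
    exact hint.add (hp1.sub hq1)
  · rw [heq, integral_add hint (by fun_prop), integral_sub hp1 hq1, hpq]
    linarith

lemma llr_ae_eq_sub {X : Type*} [MeasurableSpace X] {ν κ μ : Measure X} [SigmaFinite ν]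
    [SigmaFinite κ] [SigmaFinite μ] (hνκ : ν ≪ κ) (hκμ : κ ≪ μ) :
    llr ν κ =ᵐ[ν] fun x ↦ llr ν μ x - llr κ μ x := by
  have hνμ := hνκ.trans hκμ
  filter_upwards [hνμ.ae_le (Measure.rnDeriv_mul_rnDeriv (κ := μ) hνκ),
    Measure.rnDeriv_pos hνκ, hνκ.ae_le (Measure.rnDeriv_pos hκμ),
    hνκ.ae_le (Measure.rnDeriv_lt_top ν κ), hνμ.ae_le (Measure.rnDeriv_lt_top κ μ)]
    with x hx h1 h2 h3 h4
  have h1' := ENNReal.toReal_pos h1.ne' h3.ne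
  have h2' := ENNReal.toReal_pos h2.ne' h4.ne
  simp only [llr, ← hx, Pi.mul_apply, ENNReal.toReal_mul, Real.log_mul h1'.ne' h2'.ne']
  ring

lemma KLdiv_lt_top_iff {X : Type*} [MeasurableSpace X] {ν μ : Measure X} :
    KLdiv ν μ < ⊤ ↔ ν ≪ μ ∧ Integrable (llr ν μ) ν := by
  unfold KLdiv
  split_ifs with h
  · simp only [h, EReal.coe_lt_top, and_self]
  · simp [h]

lemma KLdiv_eq_coe_integral {X : Type*} [MeasurableSpace X] {ν μ : Measure X} (hac : ν ≪ μ)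
    (hint : Integrable (llr ν μ) ν) : KLdiv ν μ = ((∫ a, llr ν μ a ∂ν : ℝ) : EReal) :=
  if_pos ⟨hac, hint⟩

lemma rnDeriv_mix_toReal {X : Type*} [MeasurableSpace X] {ν κ μ : Measure X} [IsFiniteMeasure ν]
    [IsFiniteMeasure κ] [SigmaFinite μ] {t : ℝ} (ht : 0 ≤ t) (ht1 : t ≤ 1) :
    (fun x ↦ ((ENNReal.ofReal t • ν + ENNReal.ofReal (1 - t) • κ).rnDeriv μ x).toReal) =ᵐ[μ]
      fun x ↦ t * (ν.rnDeriv μ x).toReal + (1 - t) * (κ.rnDeriv μ x).toReal := by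
  have := ν.smul_finite (c := ENNReal.ofReal t) ENNReal.ofReal_ne_top
  have := κ.smul_finite (c := ENNReal.ofReal (1 - t)) ENNReal.ofReal_ne_top
  filter_upwards [Measure.rnDeriv_add' (ENNReal.ofReal t • ν) (ENNReal.ofReal (1 - t) • κ) μ,
    Measure.rnDeriv_smul_left_of_ne_top' ν μ (r := ENNReal.ofReal t) ENNReal.ofReal_ne_top,
    Measure.rnDeriv_smul_left_of_ne_top' κ μ (r := ENNReal.ofReal (1 - t)) ENNReal.ofReal_ne_top,
    Measure.rnDeriv_lt_top ν μ, Measure.rnDeriv_lt_top κ μ] with x h1 h2 h3 h4 h5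
  rw [h1, Pi.add_apply, h2, h3, Pi.smul_apply, Pi.smul_apply, smul_eq_mul, smul_eq_mul,
    ENNReal.toReal_add (ENNReal.mul_ne_top ENNReal.ofReal_ne_top h4.ne)
      (ENNReal.mul_ne_top ENNReal.ofReal_ne_top h5.ne), ENNReal.toReal_mul, ENNReal.toReal_mul,
    ENNReal.toReal_ofReal ht, ENNReal.toReal_ofReal (sub_nonneg.2 ht1)]

/-- **Pythagorean inequality for KL projections onto convex sets.** Let `C` be a convex set of
probability measures and `ν̃ ∈ C` a KL projection of `μ̃` onto `C` (i.e. a minimizer of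
`KL(·‖μ̃)` over `C`) with `KL(ν̃‖μ̃) < ∞`. Then `KL(ν̃‖μ̃) + KL(ν‖ν̃) ≤ KL(ν‖μ̃)` for every
`ν ∈ C`. -/
theorem kl_pythagorean_inequality
    {X : Type*} [MeasurableSpace X]
    (μt : Measure X) [IsProbabilityMeasure μt]
    (C : Set (Measure X)) (hCprob : ∀ ν ∈ C, IsProbabilityMeasure ν)
    (hCconv : ∀ ν₁ ∈ C, ∀ ν₂ ∈ C, ∀ θ : ℝ, 0 ≤ θ → θ ≤ 1 →
      (ENNReal.ofReal θ • ν₁ + ENNReal.ofReal (1 - θ) • ν₂ : Measure X) ∈ C)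
    (νt : Measure X) (hνt : νt ∈ C) (hfin : KLdiv νt μt < ⊤)
    (hmin : ∀ ν ∈ C, KLdiv νt μt ≤ KLdiv ν μt) :
    ∀ ν ∈ C, KLdiv νt μt + KLdiv ν νt ≤ KLdiv ν μt := by
  intro ν hν
  rcases eq_or_ne (KLdiv ν μt) ⊤ with htop | htop
  · simp [htop]
  have := hCprob ν hν
  have := hCprob νt hνt
  obtain ⟨hqac, hqint⟩ := KLdiv_lt_top_iff.1 hfin
  obtain ⟨hpac, hpint⟩ := KLdiv_lt_top_iff.1 (lt_top_iff_ne_top.2 htop)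
  have hpi := (integrable_rnDeriv_mul_log_iff hpac).2 hpint
  have hqi := (integrable_rnDeriv_mul_log_iff hqac).2 hqint
  obtain ⟨hzero, hint, hle⟩ := pythagorean_of_le_mix (μ := μt)
    (Measure.measurable_rnDeriv ν μt).ennreal_toReal
    (Measure.measurable_rnDeriv νt μt).ennreal_toReal
    (fun _ ↦ ENNReal.toReal_nonneg) (fun _ ↦ ENNReal.toReal_nonneg)
    Measure.integrable_toReal_rnDeriv Measure.integrable_toReal_rnDeriv
    (by simp [Measure.integral_toReal_rnDeriv hpac, Measure.integral_toReal_rnDeriv hqac])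
    hpi hqi (fun t ht ht1 ↦ by
      have hmC := hCconv ν hν νt hνt t ht.le ht1.le
      have := hCprob _ hmC
      have hmac : ENNReal.ofReal t • ν + ENNReal.ofReal (1 - t) • νt ≪ μt :=
        (hpac.smul_left _).add_left (hqac.smul_left _)
      have hmφ := (rnDeriv_mix_toReal (ν := ν) (κ := νt) (μ := μt) ht.le ht1.le).fun_comp
        fun x ↦ x * Real.log x
      have hmint := (integrable_rnDeriv_mul_log_iff hmac).1 ((integrable_congr hmφ).2
        (integrable_mul_log_mix (Measure.measurable_rnDeriv ν μt).ennreal_toReal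
          (Measure.measurable_rnDeriv νt μt).ennreal_toReal (fun _ ↦ ENNReal.toReal_nonneg)
          (fun _ ↦ ENNReal.toReal_nonneg) hpi hqi ht ht1))
      have hm := hmin _ hmC
      rw [KLdiv_eq_coe_integral hqac hqint, KLdiv_eq_coe_integral hmac hmint,
        EReal.coe_le_coe_iff, ← integral_rnDeriv_mul_log hqac, ← integral_rnDeriv_mul_log hmac]
        at hm
      exact hm.trans_eq (integral_congr_ae hmφ))
  have hac : ν ≪ νt := by
    refine Measure.AbsolutelyContinuous.mk fun s hs hνs ↦ ?_
    rw [← Measure.setLIntegral_rnDeriv hqac, setLIntegral_eq_zero_iff hs (by fun_prop)] at hνs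
    rw [← Measure.setLIntegral_rnDeriv hpac, setLIntegral_eq_zero_iff hs (by fun_prop)]
    filter_upwards [hνs, hzero, Measure.rnDeriv_lt_top ν μt] with x hx hx0 hxt hxs
    have := hx0 (by simp [hx hxs])
    exact ((ENNReal.toReal_eq_zero_iff _).1 this).resolve_right hxt.ne
  have hllr := llr_ae_eq_sub hac hqac
  have hllrint : Integrable (llr ν νt) ν := by
    rw [integrable_congr hllr]
    exact (integrable_rnDeriv_smul_iff (f := fun x ↦ llr ν μt x - llr νt μt x) hpac).1 hint
  rw [KLdiv_eq_coe_integral hqac hqint, KLdiv_eq_coe_integral hpac hpint,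
    KLdiv_eq_coe_integral hac hllrint, ← EReal.coe_add, EReal.coe_le_coe_iff,
    integral_congr_ae hllr, ← integral_rnDeriv_mul_log hqac, ← integral_rnDeriv_mul_log hpac,
    ← integral_rnDeriv_smul hpac]
  exact hle
end
end

section
/- First-order delay asymptotics of the CUSUM test under its design distributions: let μ̃, ν̃ be mutually absolutely continuous probability measures on X such that ℓ = log(dν̃/dμ̃) is integrable under ν̃ and I = KL(ν̃‖μ̃) = ∫ ℓ dν̃ ∈ (0, ∞). Then the CUSUM stopping time T_b satisfies lim_{b→∞} WADD^{μ̃,ν̃}(T_b)/b = 1/I, and likewise lim_{b→∞} CADD^{μ̃,ν̃}(T_b)/b = 1/I. -/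
open MeasureTheory Real ENNReal Filter

noncomputable section

/-- The natural filtration of the coordinate process on the sequence space `ℕ → X`:
`coordFil X t` is the σ-algebra generated by the observations `X_1, …, X_t`, i.e. by the first
`t` coordinates (coordinate `i` of `ω` is the observation `X_{i+1}`). -/
def coordFil (X : Type*) [MeasurableSpace X] :
    Filtration ℕ (inferInstance : MeasurableSpace (ℕ → X)) where
  seq t := MeasurableSpace.comap (fun ω (i : Fin t) => ω (i : ℕ)) inferInstance
  mono' := by
    intro s t hst
    have h : (fun (ω : ℕ → X) (i : Fin s) => ω (i : ℕ)) =
        (fun (v : Fin t → X) (i : Fin s) => v (Fin.castLE hst i)) ∘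
          (fun ω (i : Fin t) => ω (i : ℕ)) := rfl
    show MeasurableSpace.comap (fun (ω : ℕ → X) (i : Fin s) => ω (i : ℕ)) inferInstance ≤
        MeasurableSpace.comap (fun (ω : ℕ → X) (i : Fin t) => ω (i : ℕ)) inferInstance
    rw [h, ← MeasurableSpace.comap_comp]
    exact MeasurableSpace.comap_mono
      (Measurable.comap_le (measurable_pi_lambda _ fun i => measurable_pi_apply _))
  le' := fun t =>
    Measurable.comap_le (measurable_pi_lambda _ fun i => measurable_pi_apply _)

/-- A stopping time (with values in `ℕ∞ = ℕ ∪ {∞}`, time `0` unused) with respect to a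
filtration `F` on the sequence space: `{T ≤ t}` is `F t`-measurable for every `t`. -/
def IsStoppingTimeENat {X : Type*} [MeasurableSpace X]
    (F : Filtration ℕ (inferInstance : MeasurableSpace (ℕ → X))) (T : (ℕ → X) → ℕ∞) : Prop :=
  ∀ t : ℕ, MeasurableSet[F t] {ω | T ω ≤ (t : ℕ∞)}

/-- `P` is the distribution of the observation sequence with change-point `n`: a probability
measure on `ℕ → X` under which the observations `X_1, …, X_{n−1}` (coordinates `i` with
`i + 1 < n`) are i.i.d. `μ` and `X_n, X_{n+1}, …` are i.i.d. `ν`; it is characterized by its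
values on cylinder sets. -/
def IsChangeMeasure {X : Type*} [MeasurableSpace X] (μ ν : Measure X) (n : ℕ)
    (P : Measure (ℕ → X)) : Prop :=
  IsProbabilityMeasure P ∧
    ∀ (m : ℕ) (s : Fin m → Set X), (∀ i, MeasurableSet (s i)) →
      P {ω | ∀ i : Fin m, ω (i : ℕ) ∈ s i} =
        ∏ i : Fin m, (if (i : ℕ) + 1 < n then μ else ν) (s i)

/-- `P` is the i.i.d. (no change) distribution of the observation sequence: all coordinates are
i.i.d. `μ`; it is characterized by its values on cylinder sets. -/
def IsIIDMeasure {X : Type*} [MeasurableSpace X] (μ : Measure X) (P : Measure (ℕ → X)) : Prop :=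
  IsProbabilityMeasure P ∧
    ∀ (m : ℕ) (s : Fin m → Set X), (∀ i, MeasurableSet (s i)) →
      P {ω | ∀ i : Fin m, ω (i : ℕ) ∈ s i} = ∏ i : Fin m, μ (s i)

/-- The CUSUM statistic built from the log-likelihood ratio `ℓ`:
`S_0 = 0` and `S_t = max (S_{t−1}, 0) + ℓ (X_t)`, where `X_t` is coordinate `t − 1`. -/
def cusum {X : Type*} (ℓ : X → ℝ) : ℕ → (ℕ → X) → ℝ
  | 0, _ => 0
  | t + 1, ω => max (cusum ℓ t ω) 0 + ℓ (ω t)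

/-- The CUSUM stopping time with threshold `b`: `T_b = inf {t ≥ 1 : S_t ≥ b}` (equal to `∞` if
the threshold is never reached). -/
def cusumStop {X : Type*} (ℓ : X → ℝ) (b : ℝ) (ω : ℕ → X) : ℕ∞ :=
  sInf ((fun t : ℕ => (t : ℕ∞)) '' {t : ℕ | 1 ≤ t ∧ b ≤ cusum ℓ t ω})

/-- The essential supremum (under `P`) of the conditional expectation `E_P[f | G]` of a
nonnegative extended-real random variable `f` given a sub-σ-algebra `G`, characterized without
choosing a version of the conditional expectation: it is the least `c ∈ [0, ∞]` such that
`∫_A f dP ≤ c · P(A)` for every `G`-measurable set `A`. -/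
def essSupCondExp {Ω : Type*} [MeasurableSpace Ω] (P : Measure Ω) (G : MeasurableSpace Ω)
    (f : Ω → ℝ≥0∞) : ℝ≥0∞ :=
  sInf {c : ℝ≥0∞ | ∀ A : Set Ω, MeasurableSet[G] A → ∫⁻ ω in A, f ω ∂P ≤ c * P A}

/-- Lorden's worst-case average detection delay of a stopping time `T`, given the family
`P n` of change-point-`n` distributions:
`WADD(T) = sup_{n ≥ 1} esssup E_n[(T − n)⁺ | F_{n−1}]` (the subtraction `T − n` in `ℕ∞` is
truncated, so `T − n = (T − n)⁺`). -/
def WADD {X : Type*} [MeasurableSpace X] (P : ℕ → Measure (ℕ → X)) (T : (ℕ → X) → ℕ∞) : ℝ≥0∞ :=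
  ⨆ (n : ℕ) (_ : 1 ≤ n),
    essSupCondExp (P n) (coordFil X (n - 1)) (fun ω => ((T ω - (n : ℕ∞) : ℕ∞) : ℝ≥0∞))

/-- Pollak's conditional average detection delay of a stopping time `T`, given the family
`P n` of change-point-`n` distributions:
`CADD(T) = sup_{n ≥ 1} E_n[T − n | T ≥ n]`. -/
def CADD {X : Type*} [MeasurableSpace X] (P : ℕ → Measure (ℕ → X)) (T : (ℕ → X) → ℕ∞) : ℝ≥0∞ :=
  ⨆ (n : ℕ) (_ : 1 ≤ n),
    (∫⁻ ω in {ω | (n : ℕ∞) ≤ T ω}, ((T ω - (n : ℕ∞) : ℕ∞) : ℝ≥0∞) ∂(P n)) /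
      (P n) {ω | (n : ℕ∞) ≤ T ω}

/-- The expected run length `E_P[T]` of a stopping time `T` under a measure `P` on the sequence
space, as a Lebesgue integral in `[0, ∞]`. -/
def expectedRunLength {X : Type*} [MeasurableSpace X] (P : Measure (ℕ → X))
    (T : (ℕ → X) → ℕ∞) : ℝ≥0∞ :=
  ∫⁻ ω, ((T ω : ℕ∞) : ℝ≥0∞) ∂P

section CusumPathwise

variable {X : Type*} {ℓ : X → ℝ} {b : ℝ} {ω : ℕ → X}

lemma coe_lt_cusumStop_iff {t : ℕ} :
    (t : ℕ∞) < cusumStop ℓ b ω ↔ ∀ s : ℕ, 1 ≤ s → s ≤ t → cusum ℓ s ω < b := by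
  constructor
  · intro h s hs hst
    by_contra! hb
    have h1 : cusumStop ℓ b ω ≤ (s : ℕ∞) := sInf_le ⟨s, ⟨hs, hb⟩, rfl⟩
    exact absurd (h.trans_le h1) (by simpa using hst)
  · intro h
    have h1 : ((t + 1 : ℕ) : ℕ∞) ≤ cusumStop ℓ b ω := by
      refine le_sInf ?_
      rintro _ ⟨s, ⟨hs, hb⟩, rfl⟩
      have : t + 1 ≤ s := by
        by_contra! hlt
        exact absurd (h s hs (by omega)) (not_lt.2 hb)
      exact Nat.cast_le.2 this
    exact lt_of_lt_of_le (by exact_mod_cast Nat.lt_succ_self t) h1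

lemma one_le_cusumStop : 1 ≤ cusumStop ℓ b ω := by
  have h : ((0 : ℕ) : ℕ∞) < cusumStop ℓ b ω :=
    coe_lt_cusumStop_iff.2 fun s hs hs' => by omega
  exact Order.one_le_iff_pos.2 (by simpa using h)

lemma cusum_shift_le (m t : ℕ) :
    cusum ℓ t (fun i => ω (m + i)) ≤ max (cusum ℓ (m + t) ω) 0 := by
  induction t with
  | zero => exact le_max_right _ _
  | succ t ih =>
    have h : max (cusum ℓ t fun i => ω (m + i)) 0 ≤ max (cusum ℓ (m + t) ω) 0 :=
      max_le ih (le_max_right _ _)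
    exact le_max_of_le_left (add_le_add_left h _)

lemma cusum_shift_succ_le (m t : ℕ) :
    cusum ℓ (t + 1) (fun i => ω (m + i)) ≤ cusum ℓ (m + (t + 1)) ω :=
  add_le_add_left (max_le (cusum_shift_le m t) (le_max_right _ _)) _

/-- Restarting the CUSUM procedure after `m` observations can only delay the alarm. -/
lemma cusumStop_le_add_shift (m : ℕ) :
    cusumStop ℓ b ω ≤ m + cusumStop ℓ b (fun i => ω (m + i)) := by
  induction h : cusumStop ℓ b (fun i => ω (m + i)) using ENat.recTopCoe with
  | top => simp
  | coe k =>
    by_contra! hlt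
    have hk : (k : ℕ∞) < cusumStop ℓ b (fun i => ω (m + i)) := by
      refine coe_lt_cusumStop_iff.2 fun s hs hsk => ?_
      obtain ⟨s, rfl⟩ := Nat.exists_eq_succ_of_ne_zero (by omega : s ≠ 0)
      exact (cusum_shift_succ_le m s).trans_lt
        ((coe_lt_cusumStop_iff (t := m + k)).1 (by exact_mod_cast hlt) _ (by omega) (by omega))
    exact absurd hk (by rw [h]; exact lt_irrefl _)

lemma cusumStop_sub_le_shift (m : ℕ) :
    cusumStop ℓ b ω - ((m + 1 : ℕ) : ℕ∞) ≤ cusumStop ℓ b (fun i => ω (m + i)) - 1 := by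
  rw [Nat.cast_add, ← tsub_tsub]
  exact tsub_le_tsub_right (tsub_le_iff_left.2 (cusumStop_le_add_shift m)) _

/-- The increments truncated at level `B`, summed up to the CUSUM alarm, overshoot the threshold
by at most `B`. -/
lemma sum_truncated_le (hb : 0 ≤ b) {B : ℝ} (hB : 0 ≤ B) (n : ℕ) :
    ∑ t ∈ Finset.range n,
      {ω | (t : ℕ∞) < cusumStop ℓ b ω}.indicator (fun ω => min (ℓ (ω t)) B) ω ≤ b + B := by
  suffices H : ((n : ℕ∞) < cusumStop ℓ b ω → ∑ t ∈ Finset.range n,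
      {ω | (t : ℕ∞) < cusumStop ℓ b ω}.indicator (fun ω => min (ℓ (ω t)) B) ω
        ≤ max (cusum ℓ n ω) 0) ∧ ∑ t ∈ Finset.range n,
      {ω | (t : ℕ∞) < cusumStop ℓ b ω}.indicator (fun ω => min (ℓ (ω t)) B) ω ≤ b + B from H.2
  induction n with
  | zero => simp [cusum]; positivity
  | succ n ih =>
    rw [Finset.sum_range_succ]
    by_cases hn : (n : ℕ∞) < cusumStop ℓ b ω
    · rw [Set.indicator_of_mem (show ω ∈ {ω | (n : ℕ∞) < cusumStop ℓ b ω} from hn)]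
      have h1 := ih.1 hn
      refine ⟨fun _ => le_max_of_le_left (add_le_add h1 (min_le_left _ _)),
        add_le_add (h1.trans (max_le ?_ hb)) (min_le_right _ _)⟩
      rcases Nat.eq_zero_or_pos n with rfl | hpos
      · exact hb
      · exact (coe_lt_cusumStop_iff.1 hn n hpos le_rfl).le
    · rw [Set.indicator_of_notMem (show ω ∉ {ω | (n : ℕ∞) < cusumStop ℓ b ω} from hn), add_zero]
      refine ⟨fun h => absurd (lt_trans ?_ h) hn, ih.2⟩
      exact_mod_cast Nat.lt_succ_self n

lemma cusum_le_sum_add {C : ℝ} (hC : ∀ n, 0 ≤ ∑ i ∈ Finset.range n, ℓ (ω i) + C) (t : ℕ) :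
    cusum ℓ t ω ≤ ∑ i ∈ Finset.range t, ℓ (ω i) + C := by
  induction t with
  | zero => exact hC 0
  | succ t ih =>
    rw [Finset.sum_range_succ, add_right_comm]
    exact add_le_add_left (max_le ih (hC t)) _

/-- If the partial sums of `ℓ` grow at rate `I > 0`, the CUSUM statistic grows at most at any
rate `J > I`. -/
lemma exists_cusum_le_of_tendsto {I J : ℝ} (hI : 0 < I) (hJ : I < J)
    (h : Tendsto (fun n : ℕ => (∑ i ∈ Finset.range n, ℓ (ω i)) / n) atTop (nhds I)) :
    ∃ k : ℕ, ∀ t : ℕ, cusum ℓ t ω ≤ J * t + k := by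
  have h1 : BddAbove (Set.range fun n : ℕ => -∑ i ∈ Finset.range n, ℓ (ω i)) := by
    refine IsBoundedUnder.bddAbove_range ⟨0, ?_⟩
    rw [eventually_map]
    filter_upwards [h.eventually (lt_mem_nhds hI), eventually_gt_atTop 0] with n hn hpos
    have hpos' : (0 : ℝ) < n := by exact_mod_cast hpos
    rw [lt_div_iff₀ hpos'] at hn
    linarith
  have h2 : BddAbove (Set.range fun n : ℕ => ∑ i ∈ Finset.range n, ℓ (ω i) - J * n) := by
    refine IsBoundedUnder.bddAbove_range ⟨0, ?_⟩
    rw [eventually_map]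
    filter_upwards [h.eventually (gt_mem_nhds hJ), eventually_gt_atTop 0] with n hn hpos
    have hpos' : (0 : ℝ) < n := by exact_mod_cast hpos
    rw [div_lt_iff₀ hpos'] at hn
    linarith
  obtain ⟨C, hC⟩ := h1
  obtain ⟨D, hD⟩ := h2
  obtain ⟨k, hk⟩ := exists_nat_ge (C + D)
  refine ⟨k, fun t => ?_⟩
  have h3 := cusum_le_sum_add (ℓ := ℓ) (ω := ω) (C := C)
    (fun n => by linarith [hC ⟨n, rfl⟩]) t
  have h4 := hD ⟨t, rfl⟩
  simp only at h4
  linarith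

lemma ofReal_le_cusumStop_sub_one {J k : ℝ} (hJ : 0 < J)
    (h : ∀ t : ℕ, cusum ℓ t ω ≤ J * t + k) :
    ENNReal.ofReal ((b - k) / J - 1) ≤ ((cusumStop ℓ b ω - 1 : ℕ∞) : ℝ≥0∞) := by
  induction hT : cusumStop ℓ b ω using ENat.recTopCoe with
  | top => simp
  | coe j =>
    have h1 : ¬ (j : ℕ∞) < cusumStop ℓ b ω := by rw [hT]; exact lt_irrefl _
    rw [coe_lt_cusumStop_iff] at h1
    push Not at h1
    obtain ⟨s, -, hsj, hs⟩ := h1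
    have h2 : (s : ℝ) ≤ j := by exact_mod_cast hsj
    have h3 : (b - k) / J ≤ j := by
      rw [div_le_iff₀ hJ]
      nlinarith [h s]
    rw [ENat.toENNReal_sub, ENat.toENNReal_coe, ENat.toENNReal_one,
      ENNReal.ofReal_sub _ zero_le_one, ENNReal.ofReal_one]
    exact tsub_le_tsub_right ((ENNReal.ofReal_le_ofReal h3).trans_eq (by simp)) _

lemma cusumStop_le_tsum :
    ((cusumStop ℓ b ω : ℕ∞) : ℝ≥0∞) ≤
      ∑' t : ℕ, {ω | (t : ℕ∞) < cusumStop ℓ b ω}.indicator (fun _ => (1 : ℝ≥0∞)) ω := by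
  induction hT : cusumStop ℓ b ω using ENat.recTopCoe with
  | top => simp [Set.indicator, hT]
  | coe j =>
    refine le_trans ?_ (ENNReal.sum_le_tsum (Finset.range j))
    rw [Finset.sum_congr rfl (g := fun _ => (1 : ℝ≥0∞))]
    · simp
    · intro t ht
      have : (t : ℕ∞) < cusumStop ℓ b ω := by
        rw [hT]; exact_mod_cast Finset.mem_range.1 ht
      exact Set.indicator_of_mem (s := {ω | (t : ℕ∞) < cusumStop ℓ b ω}) this _

end CusumPathwise

/-- A sandwich criterion for `f b / b → c` as `b → ∞`, for extended nonnegative `f`. -/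
lemma tendsto_div_ofReal_of_affine_bounds {f : ℝ → ℝ≥0∞} {c : ℝ} (hc : 0 < c)
    (hU : ∀ u, c < u → ∃ K : ℝ, ∀ b, 0 < b → f b ≤ ENNReal.ofReal (u * b + K))
    (hL : ∀ l, 0 < l → l < c → ∃ K : ℝ, ∀ b, 0 < b → ENNReal.ofReal (l * b - K) ≤ f b) :
    Tendsto (fun b => f b / ENNReal.ofReal b) atTop (nhds (ENNReal.ofReal c)) := by
  have key : ∀ l K : ℝ, Tendsto (fun b : ℝ => ENNReal.ofReal (l * b + K) / ENNReal.ofReal b) atTop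
      (nhds (ENNReal.ofReal l)) := by
    intro l K
    have h1 : Tendsto (fun b : ℝ => ENNReal.ofReal (l + K / b)) atTop
        (nhds (ENNReal.ofReal l)) := by
      refine ENNReal.tendsto_ofReal ?_
      simpa using (tendsto_const_nhds (x := l)).add
        ((tendsto_const_nhds (x := K)).div_atTop tendsto_id)
    refine h1.congr' ?_
    filter_upwards [eventually_gt_atTop 0] with b hb
    rw [← ENNReal.ofReal_div_of_pos hb]
    congr 1
    field_simp
  refine tendsto_order.2 ⟨fun a ha => ?_, fun a ha => ?_⟩
  · obtain ⟨l, hl0, hal, hlc⟩ := ENNReal.lt_iff_exists_real_btwn.1 ha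
    have hlc' : l < c := (ENNReal.ofReal_lt_ofReal_iff hc).1 hlc
    have hl : 0 < l := ENNReal.ofReal_pos.1 ((zero_le).trans_lt hal)
    obtain ⟨K, hK⟩ := hL l hl hlc'
    filter_upwards [(key l (-K)).eventually (lt_mem_nhds hal), eventually_gt_atTop 0] with b h hb
    exact h.trans_le (ENNReal.div_le_div_right (by simpa [sub_eq_add_neg] using hK b hb) _)
  · obtain ⟨u, hu0, hcu, hua⟩ := ENNReal.lt_iff_exists_real_btwn.1 ha
    have hcu' : c < u := ENNReal.lt_ofReal_iff_toReal_lt (by simp) |>.1 hcu |> fun h => by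
      rwa [ENNReal.toReal_ofReal hc.le] at h
    obtain ⟨K, hK⟩ := hU u hcu'
    filter_upwards [(key u K).eventually (gt_mem_nhds hua), eventually_gt_atTop 0] with b h hb
    exact (ENNReal.div_le_div_right (hK b hb) _).trans_lt h

section CusumProbability

open ProbabilityTheory

variable {X : Type*} [MeasurableSpace X] {ℓ : X → ℝ} {b : ℝ}

lemma measurable_eval_coordFil {i t : ℕ} (h : i < t) :
    Measurable[coordFil X t] (fun ω : ℕ → X => ω i) :=
  (measurable_pi_apply (⟨i, h⟩ : Fin t)).comp
    (comap_measurable fun (ω : ℕ → X) (i : Fin t) => ω (i : ℕ))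

lemma measurable_cusum_coordFil (hℓ : Measurable ℓ) (t : ℕ) :
    Measurable[coordFil X t] (cusum ℓ t) := by
  induction t with
  | zero => exact measurable_const
  | succ t ih =>
    exact ((ih.mono ((coordFil X).mono t.le_succ) le_rfl).max measurable_const).add
      (hℓ.comp (measurable_eval_coordFil t.lt_succ_self))

lemma measurableSet_lt_cusumStop (hℓ : Measurable ℓ) (t : ℕ) :
    MeasurableSet[coordFil X t] {ω | (t : ℕ∞) < cusumStop ℓ b ω} := by
  have h : {ω | (t : ℕ∞) < cusumStop ℓ b ω} =
      ⋂ s : ℕ, ⋂ (_ : 1 ≤ s), ⋂ (_ : s ≤ t), {ω | cusum ℓ s ω < b} := by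
    ext ω
    simp [coe_lt_cusumStop_iff]
  rw [h]
  refine MeasurableSet.iInter fun s => MeasurableSet.iInter fun _ =>
    MeasurableSet.iInter fun hs => ?_
  exact (coordFil X).mono hs _ (measurable_cusum_coordFil hℓ s measurableSet_Iio)

lemma measurable_cusumStop (hℓ : Measurable ℓ) : Measurable (cusumStop (X := X) ℓ b) := by
  refine measurable_to_countable' fun n => ?_
  have h : ∀ t : ℕ, MeasurableSet {ω : ℕ → X | (t : ℕ∞) < cusumStop ℓ b ω} := fun t =>
    (coordFil X).le t _ (measurableSet_lt_cusumStop hℓ t)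
  induction n using ENat.recTopCoe with
  | top =>
    convert MeasurableSet.iInter h using 1
    ext ω
    simp only [Set.mem_preimage, Set.mem_singleton_iff, Set.mem_iInter, Set.mem_ofPred_eq]
    exact ENat.eq_top_iff_forall_gt
  | coe n =>
    rcases n with _ | n
    · convert MeasurableSet.empty using 1
      ext ω
      simpa using (zero_lt_one.trans_le one_le_cusumStop).ne'
    · convert (h n).diff (h (n + 1)) using 1
      ext ω
      simp only [Set.mem_preimage, Set.mem_singleton_iff, Set.mem_sdiff, Set.mem_ofPred_eq, not_lt]
      constructor
      · intro h
        rw [h]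
        exact ⟨by exact_mod_cast n.lt_succ_self, le_rfl⟩
      · rintro ⟨h1, h2⟩
        exact le_antisymm h2 (by exact_mod_cast Order.add_one_le_of_lt h1)

lemma measurable_cusumStop_sub (hℓ : Measurable ℓ) (n : ℕ∞) :
    Measurable fun ω : ℕ → X => ((cusumStop ℓ b ω - n : ℕ∞) : ℝ≥0∞) :=
  (measurable_of_countable fun k : ℕ∞ => ((k - n : ℕ∞) : ℝ≥0∞)).comp (measurable_cusumStop hℓ)

lemma measurable_shift (m : ℕ) : Measurable fun (ω : ℕ → X) (i : ℕ) => ω (m + i) :=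
  measurable_pi_lambda _ fun _ => measurable_pi_apply _

lemma ofReal_le_lintegral_cusumStop_sub_one (hℓ : Measurable ℓ) {Q : Measure (ℕ → X)}
    {J k δ : ℝ} (hJ : 0 < J) (hδ : 0 ≤ δ)
    (hk : ENNReal.ofReal δ ≤ Q {ω | ∀ t : ℕ, cusum ℓ t ω ≤ J * t + k}) :
    ENNReal.ofReal (δ * ((b - k) / J - 1)) ≤
      ∫⁻ ω, ((cusumStop ℓ b ω - 1 : ℕ∞) : ℝ≥0∞) ∂Q := by
  set A : Set (ℕ → X) := {ω | ∀ t : ℕ, cusum ℓ t ω ≤ J * t + k}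
  have hA : MeasurableSet A := by
    simp only [A, Set.ofPred_forall]
    exact MeasurableSet.iInter fun t =>
      (coordFil X).le t _ (measurable_cusum_coordFil hℓ t measurableSet_Iic)
  calc ENNReal.ofReal (δ * ((b - k) / J - 1))
      ≤ Q A * ENNReal.ofReal ((b - k) / J - 1) := by
        rw [ENNReal.ofReal_mul hδ]
        gcongr
    _ = ∫⁻ _ in A, ENNReal.ofReal ((b - k) / J - 1) ∂Q := by
        rw [setLIntegral_const, mul_comm]
    _ ≤ ∫⁻ ω in A, ((cusumStop ℓ b ω - 1 : ℕ∞) : ℝ≥0∞) ∂Q :=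
        setLIntegral_mono' hA fun ω hω => ofReal_le_cusumStop_sub_one hJ hω
    _ ≤ _ := setLIntegral_le_lintegral _ _

lemma IsChangeMeasure.eq_infinitePi {μ ν : Measure X} [IsProbabilityMeasure μ]
    [IsProbabilityMeasure ν] {n : ℕ} {P : Measure (ℕ → X)} (h : IsChangeMeasure μ ν n P) :
    P = Measure.infinitePi fun i => if i + 1 < n then μ else ν := by
  have hprob : ∀ i, IsProbabilityMeasure (if i + 1 < n then μ else ν) := fun i => by
    split_ifs <;> infer_instance
  refine Measure.eq_infinitePi _ fun s t ht => ?_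
  have h1 := h.2 (s.sup id + 1) (fun i => if (i : ℕ) ∈ s then t i else Set.univ)
    (fun i => by split_ifs; exacts [ht _, MeasurableSet.univ])
  have hs : ∀ i ∈ s, i < s.sup id + 1 := fun i hi =>
    Nat.lt_succ_of_le (Finset.le_sup (f := id) hi)
  have h2 : {ω : ℕ → X | ∀ i : Fin (s.sup id + 1),
      ω (i : ℕ) ∈ if (i : ℕ) ∈ s then t i else Set.univ} = Set.pi s t := by
    ext ω
    simp only [Set.mem_ofPred_eq, Set.mem_pi, Finset.mem_coe]
    constructor
    · intro H i hi
      have := H ⟨i, hs i hi⟩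
      rwa [if_pos hi] at this
    · intro H i
      split_ifs with hi
      exacts [H _ hi, trivial]
  rw [h2] at h1
  rw [h1, Fin.prod_univ_eq_prod_range (fun i => (if i + 1 < n then μ else ν)
    (if i ∈ s then t i else Set.univ))]
  symm
  refine Finset.prod_subset_one_on_sdiff (fun i hi => Finset.mem_range.2 (hs i hi)) ?_ ?_
  · intro i hi
    rw [if_neg (Finset.mem_sdiff.1 hi).2]
    exact (hprob i).measure_univ
  · intro i hi
    rw [if_pos hi]

section Product

variable {ρ : ℕ → Measure X} [∀ i, IsProbabilityMeasure (ρ i)]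

/-- Under a product measure, the first `m` coordinates are independent of the remaining ones. -/
lemma indep_coordFil_shift (m : ℕ) :
    Indep (coordFil X m) (MeasurableSpace.comap (fun ω i => ω (m + i)) inferInstance)
      (Measure.infinitePi ρ) := by
  have h := indep_iSup_of_disjoint (μ := Measure.infinitePi ρ)
    (m := fun i => MeasurableSpace.comap (fun ω : ℕ → X => ω i) inferInstance)
    (fun i => (measurable_pi_apply i).comap_le)
    (iIndepFun_infinitePi (P := ρ) (X := fun _ x => x) fun _ => measurable_id).iIndep
    (S := Set.Iio m) (T := Set.Ici m)
    (Set.disjoint_left.2 fun i hi hi' => not_lt.2 (Set.mem_Ici.1 hi') (Set.mem_Iio.1 hi))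
  refine indep_of_indep_of_le_left (indep_of_indep_of_le_right h ?_) ?_
  · refine Measurable.comap_le (@measurable_pi_lambda _ _ _ (_) _ _ fun i => ?_)
    exact measurable_iff_comap_le.2 (le_iSup₂_of_le (m + i) (Nat.le_add_right m i) le_rfl)
  · refine Measurable.comap_le (@measurable_pi_lambda _ _ _ (_) _ _ fun i => ?_)
    exact measurable_iff_comap_le.2 (le_iSup₂_of_le (i : ℕ) i.2 le_rfl)

lemma setLIntegral_comp_shift (m : ℕ) {A : Set (ℕ → X)} (hA : MeasurableSet[coordFil X m] A)
    {g : (ℕ → X) → ℝ≥0∞} (hg : Measurable g) :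
    ∫⁻ ω in A, g (fun i => ω (m + i)) ∂(Measure.infinitePi ρ) =
      Measure.infinitePi ρ A * ∫⁻ ω, g ω ∂(Measure.infinitePi fun i => ρ (m + i)) := by
  have hA' := (coordFil X).le m _ hA
  have h := lintegral_mul_eq_lintegral_mul_lintegral_of_independent_measurableSpace
    ((coordFil X).le m) (measurable_shift m).comap_le (indep_coordFil_shift (ρ := ρ) m)
    (f := A.indicator 1) (g := fun ω => g (fun i => ω (m + i)))
    (Measurable.indicator (@measurable_const _ _ _ (coordFil X m) 1) hA)
    (hg.comp (comap_measurable _))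
  rw [lintegral_indicator_one hA'] at h
  rw [← Measure.map_infinitePi_infinitePi_of_inj (P := ρ) (add_right_injective m),
    lintegral_map hg (measurable_shift m), ← h, ← lintegral_indicator hA']
  congr 1 with ω
  by_cases hω : ω ∈ A <;> simp [hω]

lemma integral_indicator_mul_eval (m : ℕ) {A : Set (ℕ → X)} (hA : MeasurableSet[coordFil X m] A)
    {g : X → ℝ} (hg : Measurable g) :
    ∫ ω, A.indicator (fun ω => g (ω m)) ω ∂(Measure.infinitePi ρ) =
      (Measure.infinitePi ρ).real A * ∫ x, g x ∂(ρ m) := by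
  have hA' := (coordFil X).le m _ hA
  have hgm : Measurable fun ω : ℕ → X => g (ω m) := hg.comp (measurable_pi_apply m)
  have hind : IndepFun (A.indicator (1 : (ℕ → X) → ℝ)) (fun ω => g (ω m))
      (Measure.infinitePi ρ) := by
    refine indep_of_indep_of_le_left (indep_of_indep_of_le_right
      (indep_coordFil_shift (ρ := ρ) m) ?_) ?_
    · exact Measurable.comap_le (hg.comp ((measurable_pi_apply 0).comp
        (comap_measurable fun (ω : ℕ → X) (i : ℕ) => ω (m + i))))
    · exact Measurable.comap_le
        (Measurable.indicator (@measurable_const _ _ _ (coordFil X m) 1) hA)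
  have h := hind.integral_fun_mul_eq_mul_integral
    (measurable_one.indicator hA').aestronglyMeasurable hgm.aestronglyMeasurable
  rw [integral_indicator_one hA', ← integral_map (φ := fun ω : ℕ → X => ω m)
    (measurable_pi_apply m).aemeasurable hg.aestronglyMeasurable,
    Measure.infinitePi_map_eval ρ m] at h
  rw [← h]
  congr 1 with ω
  by_cases hω : ω ∈ A <;> simp [hω]

end Product

section Delay

variable {μ ν : Measure X} [IsProbabilityMeasure μ] [IsProbabilityMeasure ν]
  {P : ℕ → Measure (ℕ → X)}

lemma IsChangeMeasure.setLIntegral_delay_le {n : ℕ} (hn : 1 ≤ n)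
    (h : IsChangeMeasure μ ν n (P n)) (hℓ : Measurable ℓ) {A : Set (ℕ → X)}
    (hA : MeasurableSet[coordFil X (n - 1)] A) :
    ∫⁻ ω in A, ((cusumStop ℓ b ω - (n : ℕ∞) : ℕ∞) : ℝ≥0∞) ∂(P n) ≤
      (∫⁻ ω, ((cusumStop ℓ b ω - 1 : ℕ∞) : ℝ≥0∞) ∂(Measure.infinitePi fun _ => ν)) * P n A := by
  obtain ⟨m, rfl⟩ := Nat.exists_eq_add_of_le' hn
  have hprob : ∀ i, IsProbabilityMeasure (if i + 1 < m + 1 then μ else ν) := fun i => by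
    split_ifs <;> infer_instance
  have h1 := setLIntegral_comp_shift (ρ := fun i => if i + 1 < m + 1 then μ else ν) m hA
    (measurable_cusumStop_sub (b := b) hℓ 1)
  have h2 : (fun i => if m + i + 1 < m + 1 then μ else ν) = fun _ : ℕ => ν := by
    ext1 i
    rw [if_neg (by omega)]
  rw [h2, ← h.eq_infinitePi] at h1
  rw [mul_comm, ← h1]
  exact lintegral_mono fun ω => ENat.toENNReal_mono (cusumStop_sub_le_shift m)

lemma IsChangeMeasure.one_eq (h : IsChangeMeasure μ ν 1 (P 1)) :
    P 1 = Measure.infinitePi fun _ => ν := by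
  simpa using h.eq_infinitePi

/-- The worst case for Lorden's criterion is a change at time `1`. -/
lemma WADD_cusumStop (hP : ∀ n, 1 ≤ n → IsChangeMeasure μ ν n (P n)) (hℓ : Measurable ℓ) :
    WADD P (cusumStop ℓ b) =
      ∫⁻ ω, ((cusumStop ℓ b ω - 1 : ℕ∞) : ℝ≥0∞) ∂(Measure.infinitePi fun _ => ν) := by
  refine le_antisymm (iSup₂_le fun n hn => sInf_le fun A hA =>
    (hP n hn).setLIntegral_delay_le hn hℓ hA) ?_
  refine le_iSup₂_of_le 1 le_rfl (le_sInf fun c hc => ?_)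
  have h := hc Set.univ MeasurableSet.univ
  rw [(hP 1 le_rfl).one_eq] at h
  simpa using h

/-- The worst case for Pollak's criterion is a change at time `1`. -/
lemma CADD_cusumStop (hP : ∀ n, 1 ≤ n → IsChangeMeasure μ ν n (P n)) (hℓ : Measurable ℓ) :
    CADD P (cusumStop ℓ b) =
      ∫⁻ ω, ((cusumStop ℓ b ω - 1 : ℕ∞) : ℝ≥0∞) ∂(Measure.infinitePi fun _ => ν) := by
  refine le_antisymm (iSup₂_le fun n hn => ?_) ?_
  · refine ENNReal.div_le_of_le_mul ((hP n hn).setLIntegral_delay_le hn hℓ ?_)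
    convert measurableSet_lt_cusumStop (b := b) hℓ (n - 1) using 1
    ext ω
    obtain ⟨m, rfl⟩ := Nat.exists_eq_add_of_le' hn
    simp only [Set.mem_ofPred_eq, Nat.add_sub_cancel, Nat.cast_add, Nat.cast_one]
    exact ENat.add_one_le_iff (ENat.natCast_ne_top m)
  · refine le_iSup₂_of_le 1 le_rfl ?_
    have h : {ω : ℕ → X | ((1 : ℕ) : ℕ∞) ≤ cusumStop ℓ b ω} = Set.univ :=
      Set.eq_univ_of_forall fun ω => by simpa using one_le_cusumStop
    rw [h, (hP 1 le_rfl).one_eq]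
    simp

lemma lintegral_cusumStop_le (hℓ : Measurable ℓ) (hint : Integrable ℓ ν) {B : ℝ} (hB : 0 ≤ B)
    (hpos : 0 < ∫ x, min (ℓ x) B ∂ν) (hb : 0 ≤ b) :
    ∫⁻ ω, ((cusumStop ℓ b ω : ℕ∞) : ℝ≥0∞) ∂(Measure.infinitePi fun _ => ν) ≤
      ENNReal.ofReal ((b + B) / ∫ x, min (ℓ x) B ∂ν) := by
  set Q := Measure.infinitePi fun _ : ℕ => ν
  have hmeas : ∀ t : ℕ, MeasurableSet {ω : ℕ → X | (t : ℕ∞) < cusumStop ℓ b ω} := fun t =>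
    (coordFil X).le t _ (measurableSet_lt_cusumStop hℓ t)
  have hmin : Integrable (fun x => min (ℓ x) B) ν := hint.inf (integrable_const B)
  have hcoord : ∀ t : ℕ, Integrable (fun ω : ℕ → X => min (ℓ (ω t)) B) Q := fun t =>
    (measurePreserving_eval_infinitePi (fun _ : ℕ => ν) t).integrable_comp_of_integrable hmin
  refine (lintegral_mono fun ω => cusumStop_le_tsum).trans ?_
  rw [lintegral_tsum fun t => (measurable_const.indicator (hmeas t)).aemeasurable]
  refine ENNReal.tsum_le_of_sum_range_le fun n => ?_
  have h1 : ∑ t ∈ Finset.range n, Q.real {ω | (t : ℕ∞) < cusumStop ℓ b ω} ≤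
      (b + B) / ∫ x, min (ℓ x) B ∂ν := by
    rw [le_div_iff₀ hpos, Finset.sum_mul]
    have hwald : ∀ t : ℕ, Q.real {ω | (t : ℕ∞) < cusumStop ℓ b ω} * ∫ x, min (ℓ x) B ∂ν =
        ∫ ω, {ω | (t : ℕ∞) < cusumStop ℓ b ω}.indicator (fun ω => min (ℓ (ω t)) B) ω ∂Q :=
      fun t => (integral_indicator_mul_eval (ρ := fun _ => ν) t
        (measurableSet_lt_cusumStop hℓ t) (hℓ.min measurable_const)).symm
    simp_rw [hwald]
    rw [← integral_finsetSum _ fun t _ => (hcoord t).indicator (hmeas t)]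
    calc _ ≤ ∫ _, (b + B) ∂Q := integral_mono
          (integrable_finsetSum _ fun t _ => (hcoord t).indicator (hmeas t))
          (integrable_const _) fun ω => sum_truncated_le hb hB n
      _ = b + B := by simp
  refine le_trans (le_of_eq ?_) (ENNReal.ofReal_le_ofReal h1)
  rw [ENNReal.ofReal_sum_of_nonneg fun _ _ => measureReal_nonneg]
  refine Finset.sum_congr rfl fun t _ => ?_
  rw [lintegral_indicator_const (hmeas t), one_mul, ofReal_measureReal]

lemma tendsto_integral_min_atTop {f : X → ℝ} (hf : Integrable f ν) :
    Tendsto (fun B : ℝ => ∫ x, min (f x) B ∂ν) atTop (nhds (∫ x, f x ∂ν)) := by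
  refine tendsto_integral_filter_of_dominated_convergence (fun x => |f x|) ?_ ?_ hf.abs ?_
  · exact Eventually.of_forall fun B =>
      (hf.inf (integrable_const B)).aestronglyMeasurable
  · filter_upwards [eventually_ge_atTop 0] with B hB
    refine Eventually.of_forall fun x => ?_
    rw [Real.norm_eq_abs]
    refine abs_le.2 ⟨le_min (neg_abs_le _) ?_, (min_le_left _ _).trans (le_abs_self _)⟩
    linarith [abs_nonneg (f x)]
  · refine Eventually.of_forall fun x => tendsto_const_nhds.congr' ?_
    filter_upwards [eventually_ge_atTop (f x)] with B hB
    exact (min_eq_left hB).symm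

lemma exists_measure_cusum_le_gt (hℓ : Measurable ℓ) (hint : Integrable ℓ ν)
    (hI : 0 < ∫ x, ℓ x ∂ν) {J : ℝ} (hJ : ∫ x, ℓ x ∂ν < J) {δ : ℝ≥0∞} (hδ : δ < 1) :
    ∃ k : ℕ, δ < Measure.infinitePi (fun _ => ν) {ω | ∀ t : ℕ, cusum ℓ t ω ≤ J * t + k} := by
  set Q := Measure.infinitePi fun _ : ℕ => ν
  have hmp : ∀ i : ℕ, MeasurePreserving (fun ω : ℕ → X => ω i) Q ν := fun i =>
    measurePreserving_eval_infinitePi (fun _ : ℕ => ν) i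
  have hslln := strong_law_ae_real (μ := Q) (fun i ω => ℓ (ω i))
    ((hmp 0).integrable_comp_of_integrable hint)
    (fun i j hij => (iIndepFun_infinitePi (P := fun _ : ℕ => ν) (X := fun _ => ℓ)
      fun _ => hℓ).indepFun hij)
    (fun i => IdentDistrib.comp ⟨(hmp i).aemeasurable, (hmp 0).aemeasurable,
      (hmp i).map_eq.trans (hmp 0).map_eq.symm⟩ hℓ)
  have hmean : ∫ ω, ℓ (ω 0) ∂Q = ∫ x, ℓ x ∂ν := by
    rw [← (hmp 0).map_eq, integral_map (hmp 0).aemeasurable hℓ.aestronglyMeasurable]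
  rw [hmean] at hslln
  have hmono : Monotone fun k : ℕ => {ω : ℕ → X | ∀ t : ℕ, cusum ℓ t ω ≤ J * t + k} := by
    intro k k' hk ω hω t
    have : (k : ℝ) ≤ k' := by exact_mod_cast hk
    exact (hω t).trans (by linarith)
  have hone : Q (⋃ k : ℕ, {ω : ℕ → X | ∀ t : ℕ, cusum ℓ t ω ≤ J * t + k}) = 1 := by
    refine (measure_congr (eventuallyEq_univ.2 ?_)).trans measure_univ
    filter_upwards [hslln] with ω hω
    exact Set.mem_iUnion.2 (exists_cusum_le_of_tendsto hI hJ hω)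
  have hlim := tendsto_measure_iUnion_atTop (μ := Q) hmono
  rw [hone] at hlim
  exact (hlim.eventually (lt_mem_nhds hδ)).exists

/-- First-order asymptotics of the expected CUSUM delay for i.i.d. observations with positive
mean score. -/
lemma tendsto_lintegral_cusumStop_div (hℓ : Measurable ℓ) (hint : Integrable ℓ ν)
    (hI : 0 < ∫ x, ℓ x ∂ν) :
    Tendsto (fun b : ℝ => (∫⁻ ω, ((cusumStop ℓ b ω - 1 : ℕ∞) : ℝ≥0∞)
      ∂(Measure.infinitePi fun _ => ν)) / ENNReal.ofReal b) atTop
      (nhds (ENNReal.ofReal (∫ x, ℓ x ∂ν)⁻¹)) := by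
  refine tendsto_div_ofReal_of_affine_bounds (inv_pos.2 hI) (fun u hu => ?_) fun l hl0 hl => ?_
  · have hu0 : 0 < u := (inv_pos.2 hI).trans hu
    obtain ⟨B, hBu, hB⟩ := (((tendsto_integral_min_atTop hint).eventually
      (lt_mem_nhds (inv_lt_of_inv_lt₀ hI hu))).and (eventually_ge_atTop 0)).exists
    have hpos : 0 < ∫ x, min (ℓ x) B ∂ν := (inv_pos.2 hu0).trans hBu
    refine ⟨u * B, fun b hb => (lintegral_mono fun ω => ENat.toENNReal_mono tsub_le_self).trans
      ((lintegral_cusumStop_le hℓ hint hB hpos hb.le).trans (ENNReal.ofReal_le_ofReal ?_))⟩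
    rw [← mul_add, div_eq_mul_inv, mul_comm]
    exact mul_le_mul_of_nonneg_right (inv_lt_of_inv_lt₀ hu0 hBu).le (by positivity)
  · obtain ⟨J, hIJ, hJl⟩ := exists_between ((lt_inv_comm₀ hl0 hI).1 hl)
    have hJ : 0 < J := hI.trans hIJ
    have hlJ : l * J < 1 := by
      rwa [lt_inv_comm₀ hJ hl0, ← one_div, lt_div_iff₀ hJ] at hJl
    obtain ⟨k, hk⟩ := exists_measure_cusum_le_gt hℓ hint hI hIJ
      (δ := ENNReal.ofReal (l * J)) (by rwa [ENNReal.ofReal_lt_one])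
    refine ⟨l * k + l * J, fun b _ => ?_⟩
    convert ofReal_le_lintegral_cusumStop_sub_one (b := b) hℓ hJ (by positivity) hk.le using 2
    field_simp
    ring

end Delay

end CusumProbability

/-- **First-order delay asymptotics of the CUSUM test under its design distributions.**
Let `μ̃, ν̃` be mutually absolutely continuous probability measures with
`ℓ = log (dν̃/dμ̃)` integrable under `ν̃` and `I = KL(ν̃‖μ̃) = ∫ ℓ dν̃ ∈ (0, ∞)`, and let
`P n` be the distribution of the observation sequence with change-point `n` (pre-change `μ̃`,
post-change `ν̃`). Then `WADD^{μ̃,ν̃}(T_b)/b → 1/I` and `CADD^{μ̃,ν̃}(T_b)/b → 1/I` as the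
threshold `b → ∞`. -/
theorem cusum_delay_asymptotics
    {X : Type*} [MeasurableSpace X] [MetricSpace X] [PolishSpace X] [BorelSpace X]
    (μt νt : Measure X) [IsProbabilityMeasure μt] [IsProbabilityMeasure νt]
    (hac1 : νt ≪ μt) (hac2 : μt ≪ νt)
    (hint : Integrable (llr νt μt) νt)
    (hIpos : 0 < ∫ a, llr νt μt a ∂νt)
    (P : ℕ → Measure (ℕ → X)) (hP : ∀ n : ℕ, 1 ≤ n → IsChangeMeasure μt νt n (P n)) :
    Tendsto (fun b : ℝ => WADD P (cusumStop (llr νt μt) b) / ENNReal.ofReal b) atTop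
      (nhds (ENNReal.ofReal (∫ a, llr νt μt a ∂νt)⁻¹)) ∧
    Tendsto (fun b : ℝ => CADD P (cusumStop (llr νt μt) b) / ENNReal.ofReal b) atTop
      (nhds (ENNReal.ofReal (∫ a, llr νt μt a ∂νt)⁻¹)) := by
  have hℓ := measurable_llr νt μt
  simp_rw [WADD_cusumStop hP hℓ, CADD_cusumStop hP hℓ, and_self]
  exact tendsto_lintegral_cusumStop_div hℓ hint hIpos
end
end
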